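/- Let δ = 1 − (1 + log log 2)/log 2. There is an absolute constant C > 0 with the following property. Let F be a finite field with q elements, let n ≥ 2, let 1 ≤ k ≤ n/2, and let a ∈ {1, −1}. Then the number of *-symmetric monic polynomials f of degree n over F with constant coefficient a that have a *-symmetric monic divisor of degree k is at most C·N·k^{−δ}·(1 + log k)^{−1/2}, where N is the total number of *-symmetric monic polynomials of degree n over F with constant coefficient a. -/

import Mathlib

open Polynomial

/-- `f` is *-symmetric: `f(0) ≠ 0` and `f* = f`, where `f*(X) = Xⁿ f(1/X)/f(0)`. -/
def IsStarSymm {F : Type} [Field F] (f : F[X]) : Prop :=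
  f.coeff 0 ≠ 0 ∧ f.reverse = Polynomial.C (f.coeff 0) * f

/-- The Ford constant `δ = 1 - (1 + log log 2)/log 2 ≈ 0.086`. -/
noncomputable def fordDelta : ℝ := 1 - (1 + Real.log (Real.log 2)) / Real.log 2

/-- The sequence `∏_{i ≤ r} max (Λ / i) (2 / 3)`: it agrees with `Λ ^ r / r!` for `r ≤ 3 Λ / 2` and
decays geometrically afterwards. -/
noncomputable def cappedPoisson (Λ : ℝ) : ℕ → ℝ
  | 0 => 1
  | r + 1 => cappedPoisson Λ r * max (Λ / (r + 1)) (2 / 3)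

theorem cappedPoisson_pos (Λ : ℝ) (r : ℕ) : 0 < cappedPoisson Λ r := by
  induction r with
  | zero => simp [cappedPoisson]
  | succ r ih => exact mul_pos ih (lt_max_of_lt_right (by norm_num))

theorem cappedPoisson_le_mul_pow (Λ : ℝ) (r i : ℕ) :
    cappedPoisson Λ r ≤ (3 / 2) ^ i * cappedPoisson Λ (r + i) := by
  induction i with
  | zero => simp
  | succ i ih =>
    have h := mul_le_mul_of_nonneg_left (le_max_right (Λ / ((r + i : ℕ) + 1)) (2 / 3))
      (cappedPoisson_pos Λ (r + i)).le
    have e : cappedPoisson Λ (r + (i + 1)) =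
      cappedPoisson Λ (r + i) * max (Λ / ((r + i : ℕ) + 1)) (2 / 3) := rfl
    rw [e, pow_succ]
    nlinarith [pow_pos (show (0 : ℝ) < 3 / 2 by norm_num) i]

theorem cappedPoisson_sub_le (Λ : ℝ) {r i : ℕ} (h : i ≤ r) :
    cappedPoisson Λ (r - i) ≤ (3 / 2) ^ i * cappedPoisson Λ r := by
  simpa [Nat.sub_add_cancel h] using cappedPoisson_le_mul_pow Λ (r - i) i

theorem mul_cappedPoisson_le (Λ : ℝ) (r : ℕ) :
    Λ * cappedPoisson Λ r ≤ (r + 1) * cappedPoisson Λ (r + 1) := by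
  have h := mul_le_mul_of_nonneg_left (le_max_left (Λ / (r + 1)) (2 / 3))
    (cappedPoisson_pos Λ r).le
  have hr : (0 : ℝ) < r + 1 := by positivity
  calc Λ * cappedPoisson Λ r = (r + 1) * (cappedPoisson Λ r * (Λ / (r + 1))) := by field_simp
    _ ≤ _ := mul_le_mul_of_nonneg_left h hr.le

theorem cappedPoisson_eq {Λ : ℝ} {r : ℕ} (h : (r : ℝ) ≤ 3 / 2 * Λ) :
    cappedPoisson Λ r = Λ ^ r / r.factorial := by
  induction r with
  | zero => simp [cappedPoisson]
  | succ r ih =>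
    push_cast at h
    have hr : (0 : ℝ) < r + 1 := by positivity
    have : 2 / 3 ≤ Λ / (r + 1) := by rw [le_div_iff₀ hr]; linarith
    rw [cappedPoisson, ih (by linarith), max_eq_left this, Nat.factorial_succ]
    push_cast
    field_simp
    ring

theorem cappedPoisson_add_le {Λ : ℝ} {R : ℕ} (h : Λ ≤ 4 / 5 * (R + 1)) (s : ℕ) :
    cappedPoisson Λ (R + s) ≤ (4 / 5) ^ s * cappedPoisson Λ R := by
  induction s with
  | zero => simp
  | succ s ih =>
    have e : cappedPoisson Λ (R + (s + 1)) =
      cappedPoisson Λ (R + s) * max (Λ / ((R + s : ℕ) + 1)) (2 / 3) := rfl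
    have hm : max (Λ / ((R + s : ℕ) + 1)) (2 / 3) ≤ (4 / 5 : ℝ) := by
      refine max_le ?_ (by norm_num)
      rw [div_le_iff₀ (by positivity)]
      push_cast
      have : (0 : ℝ) ≤ s := by positivity
      linarith
    calc cappedPoisson Λ (R + (s + 1)) ≤ cappedPoisson Λ (R + s) * (4 / 5) := by
          rw [e]; exact mul_le_mul_of_nonneg_left hm (cappedPoisson_pos Λ _).le
      _ ≤ _ := by rw [pow_succ]; linarith

theorem sum_range_geom_le {x : ℝ} (h0 : 0 ≤ x) (h1 : x < 1) (n : ℕ) :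
    ∑ i ∈ Finset.range n, x ^ i ≤ (1 - x)⁻¹ := by
  rw [← tsum_geometric_of_lt_one h0 h1]
  exact (summable_geometric_of_lt_one h0 h1).sum_le_tsum _ (fun i _ => by positivity)

theorem sum_cappedPoisson_Ioc_le {Λ : ℝ} {R : ℕ} (h : Λ ≤ 4 / 5 * (R + 1)) (M : ℕ) :
    ∑ r ∈ Finset.Ioc R M, cappedPoisson Λ r ≤ 5 * cappedPoisson Λ R := by
  have hsub : Finset.Ioc R M ⊆ (Finset.range (M + 1)).image (fun s => R + s) := by
    intro r hr
    rw [Finset.mem_Ioc] at hr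
    exact Finset.mem_image.2 ⟨r - R, by simp; omega, by omega⟩
  calc ∑ r ∈ Finset.Ioc R M, cappedPoisson Λ r
      ≤ ∑ r ∈ (Finset.range (M + 1)).image (fun s => R + s), cappedPoisson Λ r :=
        Finset.sum_le_sum_of_subset_of_nonneg hsub fun _ _ _ => (cappedPoisson_pos Λ _).le
    _ = ∑ s ∈ Finset.range (M + 1), cappedPoisson Λ (R + s) :=
        Finset.sum_image (by simp)
    _ ≤ ∑ s ∈ Finset.range (M + 1), (4 / 5) ^ s * cappedPoisson Λ R :=
        Finset.sum_le_sum fun s _ => cappedPoisson_add_le h s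
    _ ≤ 5 * cappedPoisson Λ R := by
        rw [← Finset.sum_mul]
        refine mul_le_mul_of_nonneg_right ?_ (cappedPoisson_pos Λ _).le
        exact (sum_range_geom_le (by norm_num) (by norm_num) _).trans (by norm_num)

theorem le_cappedPoisson_mul {S p : ℕ → ℝ} {Λ : ℝ} (hS : ∀ r, 0 ≤ S r) (hp0 : 0 ≤ p 0)
    (hp : p 0 + 6 ≤ Λ) (hpi : ∀ i, 1 ≤ i → p i ≤ 2 * (1 / 2) ^ i)
    (hrec : ∀ r : ℕ, (r + 1) * S (r + 1) ≤ ∑ i ∈ Finset.range (r + 1), p i * S (r - i)) (r : ℕ) :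
    S r ≤ cappedPoisson Λ r * S 0 := by
  induction r using Nat.strong_induction_on with
  | _ r ih =>
    rcases r with _ | r
    · simp [cappedPoisson]
    have hr : (0 : ℝ) < r + 1 := by positivity
    refine le_of_mul_le_mul_left ?_ hr
    have hT := (cappedPoisson_pos Λ r).le
    have key : ∀ i ∈ Finset.range (r + 1), p i * S (r - i) ≤
        (if i = 0 then Λ - 6 else 2 * (3 / 4) ^ i) * (cappedPoisson Λ r * S 0) := by
      intro i hi
      have hi' : i ≤ r := by simpa [Nat.lt_succ_iff] using hi
      have h1 := ih (r - i) (by omega)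
      rcases Nat.eq_zero_or_pos i with rfl | hpos
      · simp only [if_true]
        calc p 0 * S (r - 0) ≤ p 0 * (cappedPoisson Λ (r - 0) * S 0) :=
              mul_le_mul_of_nonneg_left h1 hp0
          _ ≤ _ := mul_le_mul_of_nonneg_right (by linarith) (mul_nonneg hT (hS 0))
      · rw [if_neg hpos.ne']
        calc p i * S (r - i) ≤ (2 * (1 / 2) ^ i) * S (r - i) :=
              mul_le_mul_of_nonneg_right (hpi i hpos) (hS _)
          _ ≤ (2 * (1 / 2) ^ i) * (((3 / 2) ^ i * cappedPoisson Λ r) * S 0) := by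
              refine mul_le_mul_of_nonneg_left (h1.trans ?_) (by positivity)
              exact mul_le_mul_of_nonneg_right (cappedPoisson_sub_le Λ hi') (hS 0)
          _ = _ := by
              rw [show (3 / 4 : ℝ) = (1 / 2) * (3 / 2) by norm_num, mul_pow]; ring
    have hsum : ∑ i ∈ Finset.range (r + 1), (if i = 0 then Λ - 6 else 2 * (3 / 4 : ℝ) ^ i) ≤ Λ := by
      rw [Finset.sum_range_succ']
      simp only [if_true, Nat.add_eq_zero_iff, one_ne_zero, and_false, if_false]
      have : ∑ i ∈ Finset.range r, 2 * (3 / 4 : ℝ) ^ (i + 1) =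
          3 / 2 * ∑ i ∈ Finset.range r, (3 / 4 : ℝ) ^ i := by
        rw [Finset.mul_sum]; exact Finset.sum_congr rfl fun i _ => by ring
      rw [this]
      have := sum_range_geom_le (x := 3 / 4) (by norm_num) (by norm_num) r
      norm_num at this ⊢
      linarith
    calc ((r : ℝ) + 1) * S (r + 1) ≤ ∑ i ∈ Finset.range (r + 1), p i * S (r - i) := hrec r
      _ ≤ _ := Finset.sum_le_sum key
      _ ≤ Λ * (cappedPoisson Λ r * S 0) := by
          rw [← Finset.sum_mul]
          exact mul_le_mul_of_nonneg_right hsum (mul_nonneg hT (hS 0))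
      _ = Λ * cappedPoisson Λ r * S 0 := by ring
      _ ≤ _ := by
          rw [← mul_assoc]
          exact mul_le_mul_of_nonneg_right (mul_cappedPoisson_le Λ r) (hS 0)

theorem sum_Icc_inv_le (j : ℕ) : ∑ e ∈ Finset.Icc 1 j, (1 / e : ℝ) ≤ 1 + Real.log j := by
  have := harmonic_le_one_add_log j
  rw [harmonic_eq_sum_Icc] at this
  simpa using this

theorem sum_Icc_inv_mul_pow_le {i : ℕ} (hi : 1 ≤ i) (j : ℕ) :
    ∑ e ∈ Finset.Icc 1 j, (1 / e : ℝ) * (1 / 2) ^ (i * e) ≤ 2 * (1 / 2) ^ i := by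
  have h2 : ((1 : ℝ) / 2) ^ i ≤ 1 / 2 := by
    simpa using pow_le_pow_of_le_one (show (0 : ℝ) ≤ 1 / 2 by norm_num) (by norm_num) hi
  have h0 : (0 : ℝ) < (1 / 2) ^ i := by positivity
  calc ∑ e ∈ Finset.Icc 1 j, (1 / e : ℝ) * (1 / 2) ^ (i * e)
      ≤ ∑ e ∈ Finset.Icc 1 j, ((1 / 2 : ℝ) ^ i) ^ e := by
        refine Finset.sum_le_sum fun e he => ?_
        rw [pow_mul]
        have : (1 : ℝ) ≤ e := by exact_mod_cast (Finset.mem_Icc.1 he).1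
        exact mul_le_of_le_one_left (by positivity) (by rw [div_le_one (by linarith)]; exact this)
    _ = ∑ e ∈ Finset.range j, ((1 / 2 : ℝ) ^ i) ^ (e + 1) := by
        rw [Finset.range_eq_Ico, Finset.sum_Ico_add' (fun e => ((1 / 2 : ℝ) ^ i) ^ e)]
        rfl
    _ = (1 / 2 : ℝ) ^ i * ∑ e ∈ Finset.range j, ((1 / 2 : ℝ) ^ i) ^ e := by
        rw [Finset.mul_sum]; exact Finset.sum_congr rfl fun e _ => by ring
    _ ≤ (1 / 2 : ℝ) ^ i * 2 := by
        refine mul_le_mul_of_nonneg_left ?_ h0.le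
        refine (sum_range_geom_le h0.le (by linarith) j).trans ?_
        rw [inv_le_comm₀ (by linarith) (by norm_num)]
        linarith
    _ = _ := by ring

theorem sum_Icc_sub_eq (f : ℕ → ℝ) (d : ℕ) :
    ∑ e ∈ Finset.Icc 1 d, f (d - e) = ∑ x ∈ Finset.range d, f x := by
  refine Finset.sum_nbij' (fun e => d - e) (fun x => d - x) ?_ ?_ ?_ ?_ ?_ <;>
    simp <;> intros <;> omega

theorem sum_ite_mul_le {M : Type*} [AddCommMonoid M] [PartialOrder M] [IsOrderedAddMonoid M]
    {f : ℕ → M} (hf : ∀ x, 0 ≤ f x) {c : ℕ} (hc : 1 ≤ c) (s : Finset ℕ)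
    (hs : ∀ x ∈ s, 1 ≤ x) (d : ℕ) :
    ∑ x ∈ s, (if c * x ≤ d then f (c * x) else 0) ≤
      ∑ e ∈ Finset.Icc 1 d, if c ∣ e then f e else 0 := by
  rw [← Finset.sum_filter, ← Finset.sum_filter]
  calc ∑ x ∈ s with c * x ≤ d, f (c * x)
      = ∑ e ∈ (s.filter (fun x => c * x ≤ d)).image (fun x => c * x), f e := by
        rw [Finset.sum_image]
        intro x _ y _ h
        exact Nat.eq_of_mul_eq_mul_left hc h
    _ ≤ _ := by
        refine Finset.sum_le_sum_of_subset_of_nonneg ?_ fun _ _ _ => hf _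
        intro e he
        simp only [Finset.mem_image, Finset.mem_filter, Finset.mem_Icc] at he ⊢
        obtain ⟨x, ⟨hx, hxd⟩, rfl⟩ := he
        exact ⟨⟨Nat.mul_pos hc (hs x hx), hxd⟩, dvd_mul_right _ _⟩

theorem sum_range_shift_le {f : ℕ → ℝ} (hf : ∀ x, 0 ≤ f x) (c D : ℕ) :
    ∑ d ∈ Finset.range D, (if c ≤ d then f (d - c) else 0) ≤ ∑ d ∈ Finset.range D, f d := by
  rw [← Finset.sum_filter]
  calc ∑ d ∈ Finset.range D with c ≤ d, f (d - c)
      = ∑ e ∈ ((Finset.range D).filter (fun d => c ≤ d)).image (fun d => d - c), f e := by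
        rw [Finset.sum_image]
        intro x hx y hy h
        simp at hx hy h
        omega
    _ ≤ _ := by
        refine Finset.sum_le_sum_of_subset_of_nonneg ?_ fun _ _ _ => hf _
        intro e he
        simp only [Finset.mem_image, Finset.mem_filter, Finset.mem_range] at he ⊢
        omega

section Recurrence

variable {A : ℕ → ℕ → ℝ} {j : ℕ}

theorem rough_density_le (hj : 1 ≤ j) (h00 : A 0 0 ≤ 1)
    (hrec : ∀ d : ℕ, d * A 0 d ≤ ∑ e ∈ Finset.Ioc j d, A 0 (d - e)) {d : ℕ} (hd : 1 ≤ d) :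
    A 0 d ≤ 1 / j := by
  have hj' : (0 : ℝ) < j := by exact_mod_cast hj
  induction d using Nat.strong_induction_on with
  | _ d ih =>
    have hd' : (0 : ℝ) < d := by exact_mod_cast hd
    refine le_of_mul_le_mul_left ((hrec d).trans ?_) hd'
    rcases le_or_gt d j with hdj | hdj
    · rw [Finset.Ioc_eq_empty (by omega), Finset.sum_empty]; positivity
    obtain ⟨t, rfl⟩ : ∃ t, d = j + 1 + t := ⟨d - (j + 1), by omega⟩
    have : ∑ e ∈ Finset.Ioc j (j + 1 + t), A 0 (j + 1 + t - e) =
        ∑ x ∈ Finset.range (t + 1), A 0 x := by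
      refine Finset.sum_nbij' (fun e => j + 1 + t - e) (fun x => j + 1 + t - x) ?_ ?_ ?_ ?_ ?_ <;>
        simp <;> intros <;> omega
    rw [this, Finset.sum_range_succ']
    have h1 : ∑ x ∈ Finset.range t, A 0 (x + 1) ≤ ∑ x ∈ Finset.range t, (1 / j : ℝ) := by
      refine Finset.sum_le_sum fun x hx => ih (x + 1) ?_ (by omega)
      rw [Finset.mem_range] at hx; omega
    rw [Finset.sum_const, Finset.card_range, nsmul_eq_mul] at h1
    have h2 : ((j + 1 + t : ℕ) : ℝ) * (1 / j) = 1 + 1 / j + t * (1 / j) := by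
      push_cast; field_simp
    rw [h2]
    have : (0 : ℝ) < 1 / j := by positivity
    linarith

theorem density_le_cappedPoisson (hA : ∀ r d, 0 ≤ A r d) (hj : 1 ≤ j) (h00 : A 0 0 ≤ 1)
    (hcount : ∀ r d : ℕ, ((r : ℝ) + 1) * A (r + 1) d ≤ ∑ i ∈ Finset.range (r + 1),
      ∑ e ∈ Finset.Icc 1 j, if (i + 1) * e ≤ d then
        (1 / e : ℝ) * (1 / 2) ^ (i * e) * A (r - i) (d - (i + 1) * e) else 0)
    (hdeg : ∀ r d : ℕ, (d : ℝ) * A r d ≤ ∑ e ∈ Finset.Ioc j d, A r (d - e) +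
      ∑ i ∈ Finset.range r, (1 / 2 : ℝ) ^ i * ∑ e ∈ Finset.Icc 1 j,
        if (i + 1) * e ≤ d then A (r - (i + 1)) (d - (i + 1) * e) else 0)
    {d : ℕ} (hd : 1 ≤ d) (hjd : j ≤ 2 * d) (r : ℕ) :
    A r d ≤ 21 / j * cappedPoisson (Real.log j + 7) r := by
  have hj' : (0 : ℝ) < j := by exact_mod_cast hj
  have hd' : (0 : ℝ) < d := by exact_mod_cast hd
  set Λ := Real.log j + 7 with hΛ
  set S : ℕ → ℝ := fun r => ∑ x ∈ Finset.range d, A r x with hSdef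
  have hS : ∀ r, 0 ≤ S r := fun r => Finset.sum_nonneg fun x _ => hA r x
  have hS0 : S 0 ≤ 3 * d / j := by
    obtain ⟨t, rfl⟩ : ∃ t, d = t + 1 := ⟨d - 1, by omega⟩
    have hr := fun {x : ℕ} (hx : 1 ≤ x) => rough_density_le hj h00
      (fun d => by simpa using hdeg 0 d) hx
    simp only [hSdef]
    rw [Finset.sum_range_succ']
    have h1 : ∑ x ∈ Finset.range t, A 0 (x + 1) ≤ ∑ x ∈ Finset.range t, (1 / j : ℝ) :=
      Finset.sum_le_sum fun x _ => hr (by omega)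
    rw [Finset.sum_const, Finset.card_range, nsmul_eq_mul] at h1
    have h2 : (1 : ℝ) ≤ 2 * (t + 1 : ℕ) / j := by
      rw [le_div_iff₀ hj', one_mul]; exact_mod_cast hjd
    have h3 : (3 : ℝ) * (t + 1 : ℕ) / j = 2 * (t + 1 : ℕ) / j + t * (1 / j) + 1 / j := by
      push_cast; ring
    have : (0 : ℝ) < 1 / j := by positivity
    linarith
  have hSr : ∀ r, S r ≤ cappedPoisson Λ r * S 0 := by
    refine le_cappedPoisson_mul
      (p := fun i => ∑ e ∈ Finset.Icc 1 j, (1 / e : ℝ) * (1 / 2) ^ (i * e))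
      hS (Finset.sum_nonneg fun _ _ => by positivity) ?_
      (fun i hi => sum_Icc_inv_mul_pow_le hi j) ?_
    · have := sum_Icc_inv_le j
      simp only [zero_mul, pow_zero, mul_one]
      linarith
    · intro r
      calc ((r : ℝ) + 1) * S (r + 1) = ∑ x ∈ Finset.range d, ((r : ℝ) + 1) * A (r + 1) x := by
            rw [Finset.mul_sum]
        _ ≤ _ := Finset.sum_le_sum fun x _ => hcount r x
        _ = ∑ i ∈ Finset.range (r + 1), ∑ e ∈ Finset.Icc 1 j, (1 / e : ℝ) * (1 / 2) ^ (i * e) *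
              ∑ x ∈ Finset.range d,
                if (i + 1) * e ≤ x then A (r - i) (x - (i + 1) * e) else 0 := by
            rw [Finset.sum_comm]
            refine Finset.sum_congr rfl fun i _ => ?_
            rw [Finset.sum_comm]
            refine Finset.sum_congr rfl fun e _ => ?_
            rw [Finset.mul_sum]
            exact Finset.sum_congr rfl fun x _ => by rw [mul_ite, mul_zero]
        _ ≤ _ := by
            refine Finset.sum_le_sum fun i _ => ?_
            rw [Finset.sum_mul]
            refine Finset.sum_le_sum fun e _ => ?_
            exact mul_le_mul_of_nonneg_left (sum_range_shift_le (hA _) _ _) (by positivity)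
  have hT := (cappedPoisson_pos Λ r).le
  have hbig : ∑ e ∈ Finset.Ioc j d, A r (d - e) ≤ S r := by
    rw [hSdef]
    simp only
    rw [← sum_Icc_sub_eq]
    refine Finset.sum_le_sum_of_subset_of_nonneg ?_ fun _ _ _ => hA _ _
    intro e he
    simp only [Finset.mem_Ioc, Finset.mem_Icc] at he ⊢
    omega
  have hsmall : ∀ i, ∑ e ∈ Finset.Icc 1 j,
      (if (i + 1) * e ≤ d then A (r - (i + 1)) (d - (i + 1) * e) else 0) ≤ S (r - (i + 1)) := by
    intro i
    refine (sum_ite_mul_le (f := fun x => A (r - (i + 1)) (d - x)) (fun _ => hA _ _) (by omega) _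
      (fun x hx => (Finset.mem_Icc.1 hx).1) d).trans ?_
    simp only [hSdef]
    rw [← sum_Icc_sub_eq]
    refine Finset.sum_le_sum fun e _ => ?_
    split_ifs
    · exact le_rfl
    · exact hA _ _
  have hmain : (d : ℝ) * A r d ≤ 7 * cappedPoisson Λ r * S 0 := by
    refine (hdeg r d).trans ?_
    have h1 : ∑ i ∈ Finset.range r, (1 / 2 : ℝ) ^ i * ∑ e ∈ Finset.Icc 1 j,
        (if (i + 1) * e ≤ d then A (r - (i + 1)) (d - (i + 1) * e) else 0) ≤
        ∑ i ∈ Finset.range r, (3 / 4 : ℝ) ^ i * (3 / 2 * (cappedPoisson Λ r * S 0)) := by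
      refine Finset.sum_le_sum fun i hi => ?_
      have hi' : i + 1 ≤ r := Finset.mem_range.1 hi
      calc _ ≤ (1 / 2 : ℝ) ^ i * (((3 / 2) ^ (i + 1) * cappedPoisson Λ r) * S 0) := by
            refine mul_le_mul_of_nonneg_left (((hsmall i).trans (hSr _)).trans ?_) (by positivity)
            exact mul_le_mul_of_nonneg_right (cappedPoisson_sub_le Λ hi') (hS 0)
        _ = _ := by
            rw [show (3 / 4 : ℝ) = (1 / 2) * (3 / 2) by norm_num, mul_pow]; ring
    rw [← Finset.sum_mul] at h1
    have h2 := sum_range_geom_le (x := 3 / 4) (by norm_num) (by norm_num) r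
    norm_num at h2
    have h3 : 0 ≤ cappedPoisson Λ r * S 0 := mul_nonneg hT (hS 0)
    have h4 := mul_le_mul_of_nonneg_right h2
      (show 0 ≤ 3 / 2 * (cappedPoisson Λ r * S 0) by positivity)
    linarith [hSr r]
  refine le_of_mul_le_mul_left (hmain.trans ?_) hd'
  calc 7 * cappedPoisson Λ r * S 0 ≤ 7 * cappedPoisson Λ r * (3 * d / j) :=
        mul_le_mul_of_nonneg_left hS0 (by positivity)
    _ = _ := by ring

end Recurrence

section Factors

open UniqueFactorizationMonoid

variable {F : Type} [Field F]

open Classical in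
/-- The number of irreducible factors of degree at most `j`, counted with multiplicity. -/
noncomputable def smallOmega (j : ℕ) (h : F[X]) : ℕ :=
  ((normalizedFactors h).filter fun P => P.natDegree ≤ j).card

theorem smallOmega_one (j : ℕ) : smallOmega j (1 : F[X]) = 0 := by
  simp [smallOmega]

theorem smallOmega_mul (j : ℕ) {g h : F[X]} (hg : g ≠ 0) (hh : h ≠ 0) :
    smallOmega j (g * h) = smallOmega j g + smallOmega j h := by
  classical
  unfold smallOmega
  rw [normalizedFactors_mul hg hh, Multiset.filter_add, Multiset.card_add]

theorem smallOmega_irreducible_pow (j : ℕ) {P : F[X]} (hP : Irreducible P) (i : ℕ) :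
    smallOmega j (P ^ i) = if P.natDegree ≤ j then i else 0 := by
  classical
  have hd : (normalize P).natDegree = P.natDegree := natDegree_eq_of_degree_eq degree_normalize
  induction i with
  | zero => simp [smallOmega_one]
  | succ i ih =>
    rw [pow_succ, smallOmega_mul j (pow_ne_zero _ hP.ne_zero) hP.ne_zero, ih]
    simp only [smallOmega]
    rw [normalizedFactors_irreducible hP, Multiset.filter_singleton, hd]
    split_ifs <;> simp

theorem smallOmega_le_natDegree (j : ℕ) {h : F[X]} (hh : h.Monic) :
    smallOmega j h ≤ h.natDegree := by
  classical
  have hm : ∀ P ∈ normalizedFactors h, P.Monic ∧ 1 ≤ P.natDegree := fun P hP => by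
    have := (Polynomial.mem_normalizedFactors_iff hh.ne_zero).1 hP
    exact ⟨this.2.1, this.1.natDegree_pos⟩
  have hprod : (normalizedFactors h).prod = h := by
    have := leadingCoeff_mul_prod_normalizedFactors h
    rwa [hh.leadingCoeff, map_one, one_mul] at this
  calc smallOmega j h ≤ (normalizedFactors h).card := by
        unfold smallOmega
        exact Multiset.card_le_card (Multiset.filter_le _ _)
    _ ≤ ((normalizedFactors h).map natDegree).sum := by
        have := Multiset.sum_map_le_sum_map (s := normalizedFactors h) (fun _ => 1) natDegree
          fun P hP => (hm P hP).2
        simpa using this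
    _ = h.natDegree := by
        rw [← natDegree_multiset_prod_of_monic _ fun P hP => (hm P hP).1, hprod]

open Classical in
theorem count_normalizedFactors_eq_sum {h P : F[X]} (hh : h.Monic) (hPm : P.Monic)
    (hP : Irreducible P) {D : ℕ} (hD : h.natDegree ≤ D) :
    (normalizedFactors h).count P = ∑ i ∈ Finset.range D, if P ^ (i + 1) ∣ h then 1 else 0 := by
  have hiff : ∀ n, P ^ n ∣ h ↔ n ≤ (normalizedFactors h).count P := fun n => by
    rw [pow_dvd_iff_le_emultiplicity, emultiplicity_eq_count_normalizedFactors hP hh.ne_zero,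
      hPm.normalize_eq_self, Nat.cast_le]
  have hle : (normalizedFactors h).count P ≤ D := by
    have h1 := natDegree_le_of_dvd ((hiff _).2 le_rfl) hh.ne_zero
    rw [natDegree_pow] at h1
    nlinarith [hP.natDegree_pos]
  rw [← Finset.card_filter]
  have : (Finset.range D).filter (fun i => P ^ (i + 1) ∣ h) =
      Finset.range ((normalizedFactors h).count P) := by
    ext i
    simp only [Finset.mem_filter, Finset.mem_range, hiff]
    omega
  rw [this, Finset.card_range]

end Factors

section Counting

open UniqueFactorizationMonoid

variable (F : Type) [Field F] [Fintype F]

theorem finite_monic_natDegree_eq (d : ℕ) : {h : F[X] | h.Monic ∧ h.natDegree = d}.Finite :=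
  Set.finite_coe_iff.1 ((((monicEquivDegreeLT d).trans
    (degreeLTEquiv F d).toEquiv).finite_iff).2 inferInstance)

/-- The monic polynomials of degree `d` over a finite field. -/
noncomputable def monics (d : ℕ) : Finset F[X] := (finite_monic_natDegree_eq F d).toFinset

open Classical in
/-- The monic irreducible polynomials of degree `d` over a finite field. -/
noncomputable def irreds (d : ℕ) : Finset F[X] := (monics F d).filter Irreducible

variable {F}

@[simp] theorem mem_monics {d : ℕ} {h : F[X]} : h ∈ monics F d ↔ h.Monic ∧ h.natDegree = d := by
  simp [monics]

@[simp] theorem mem_irreds {d : ℕ} {h : F[X]} :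
    h ∈ irreds F d ↔ (h.Monic ∧ h.natDegree = d) ∧ Irreducible h := by
  simp [irreds]

variable (F) in
theorem card_monics (d : ℕ) : (monics F d).card = Fintype.card F ^ d := by
  have h := Nat.card_congr ((monicEquivDegreeLT d).trans (degreeLTEquiv F d).toEquiv)
  rw [Nat.card_eq_fintype_card (α := Fin d → F), Fintype.card_fun, Fintype.card_fin] at h
  rw [← h, monics, ← Set.ncard_eq_toFinset_card _ (finite_monic_natDegree_eq F d)]
  rfl

variable (F) in
theorem sum_dvd_mul_card_irreds_le {e : ℕ} (he : 1 ≤ e) (s : Finset ℕ) (hs : ∀ x ∈ s, x ∣ e) :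
    ∑ x ∈ s, x * (irreds F x).card ≤ Fintype.card F ^ e := by
  classical
  have hdisj : (s : Set ℕ).PairwiseDisjoint (irreds F) := by
    intro x _ y _ hxy
    refine Finset.disjoint_left.2 fun P hP hP' => hxy ?_
    rw [mem_irreds] at hP hP'
    exact hP.1.2.symm.trans hP'.1.2
  have hsum : ∑ x ∈ s, x * (irreds F x).card = ∑ P ∈ s.biUnion (irreds F), P.natDegree := by
    rw [Finset.sum_biUnion hdisj]
    refine Finset.sum_congr rfl fun x _ => ?_
    rw [Finset.sum_congr rfl (fun P hP => (mem_irreds.1 hP).1.2), Finset.sum_const, smul_eq_mul,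
      mul_comm]
  have hmem : ∀ P ∈ s.biUnion (irreds F), P.Monic ∧ Irreducible P ∧ P.natDegree ∣ e := by
    intro P hP
    obtain ⟨x, hx, hP⟩ := Finset.mem_biUnion.1 hP
    rw [mem_irreds] at hP
    exact ⟨hP.1.1, hP.2, hP.1.2 ▸ hs x hx⟩
  have hdvd : ∏ P ∈ s.biUnion (irreds F), P ∣ X ^ Fintype.card F ^ e - X := by
    refine Finset.prod_dvd_of_coprime ?_ ?_
    · intro P hP Q hQ hPQ
      obtain ⟨hPm, hPi, -⟩ := hmem P hP
      obtain ⟨hQm, hQi, -⟩ := hmem Q hQ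
      refine (hPi.coprime_iff_not_dvd).2 fun h => hPQ ?_
      exact eq_of_monic_of_associated hPm hQm (hPi.associated_of_dvd hQi h)
    · intro P hP
      obtain ⟨-, hPi, hPe⟩ := hmem P hP
      have := hPi.natDegree_dvd_iff_dvd_X_pow_card_pow_sub_X.1 hPe
      rwa [Nat.card_eq_fintype_card] at this
  rw [hsum, ← natDegree_prod_of_monic _ _ fun P hP => (hmem P hP).1]
  refine (natDegree_le_of_dvd hdvd ?_).trans ?_
  · exact FiniteField.X_pow_card_pow_sub_X_ne_zero F (by omega) Fintype.one_lt_card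
  · rw [FiniteField.X_pow_card_pow_sub_X_natDegree_eq F (by omega) Fintype.one_lt_card]

variable (F) in
theorem card_irreds_div_le {e : ℕ} (he : 1 ≤ e) :
    ((irreds F e).card : ℝ) / (Fintype.card F : ℝ) ^ e ≤ 1 / e := by
  have h := sum_dvd_mul_card_irreds_le F he {e} (by simp)
  rw [Finset.sum_singleton] at h
  have h' : (e : ℝ) * (irreds F e).card ≤ (Fintype.card F : ℝ) ^ e := by exact_mod_cast h
  have : (0 : ℝ) < Fintype.card F := by exact_mod_cast Fintype.card_pos
  have he' : (0 : ℝ) < e := by exact_mod_cast he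
  rw [div_le_div_iff₀ (by positivity) he']
  linarith

open Classical in
theorem sum_irreds_sum_eq (s : Finset ℕ) (f : F[X] → ℕ) :
    ∑ e ∈ s, ∑ P ∈ irreds F e, f P =
      ∑ P ∈ (s.sigma fun e => irreds F e).image Sigma.snd, f P := by
  rw [Finset.sum_image, Finset.sum_sigma]
  rintro ⟨x, P⟩ hx ⟨y, Q⟩ hy h
  simp only [Finset.coe_sigma, Set.mem_sigma_iff, Finset.mem_coe, mem_irreds] at hx hy h
  subst h
  obtain rfl : x = y := hx.2.1.2.symm.trans hy.2.1.2
  rfl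

open Classical in
theorem smallOmega_eq_sum {j D : ℕ} {h : F[X]} (hh : h.Monic) (hD : h.natDegree ≤ D) :
    smallOmega j h = ∑ e ∈ Finset.Icc 1 j, ∑ P ∈ irreds F e, ∑ i ∈ Finset.range D,
      if P ^ (i + 1) ∣ h then 1 else 0 := by
  have e1 : smallOmega j h = ∑ e ∈ Finset.Icc 1 j, ∑ P ∈ irreds F e,
      ((normalizedFactors h).filter fun P => P.natDegree ≤ j).count P := by
    rw [sum_irreds_sum_eq, Multiset.sum_count_eq_card]
    · rfl
    · intro P hP
      rw [Multiset.mem_filter, Polynomial.mem_normalizedFactors_iff hh.ne_zero] at hP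
      simp only [Finset.mem_image, Finset.mem_sigma, mem_irreds, Finset.mem_Icc]
      exact ⟨⟨P.natDegree, P⟩, ⟨⟨hP.1.1.natDegree_pos, hP.2⟩, ⟨hP.1.2.1, rfl⟩, hP.1.1⟩, rfl⟩
  rw [e1]
  refine Finset.sum_congr rfl fun e he => Finset.sum_congr rfl fun P hP => ?_
  rw [mem_irreds] at hP
  rw [Multiset.count_filter_of_pos (by rw [hP.1.2]; exact (Finset.mem_Icc.1 he).2),
    count_normalizedFactors_eq_sum hh hP.1.1 hP.2 hD]

open Classical in
theorem natDegree_eq_sum {D : ℕ} {h : F[X]} (hh : h.Monic) (hD : h.natDegree ≤ D) :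
    h.natDegree = ∑ e ∈ Finset.Icc 1 h.natDegree, ∑ P ∈ irreds F e, ∑ i ∈ Finset.range D,
      if P ^ (i + 1) ∣ h then e else 0 := by
  have hprod : (normalizedFactors h).prod = h := by
    have := leadingCoeff_mul_prod_normalizedFactors h
    rwa [hh.leadingCoeff, map_one, one_mul] at this
  have hm : ∀ P ∈ normalizedFactors h, Irreducible P ∧ P.Monic ∧ P ∣ h := fun P hP =>
    (Polynomial.mem_normalizedFactors_iff hh.ne_zero).1 hP
  have e1 : h.natDegree = ∑ e ∈ Finset.Icc 1 h.natDegree, ∑ P ∈ irreds F e,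
      (normalizedFactors h).count P * P.natDegree := by
    rw [sum_irreds_sum_eq]
    conv_lhs => rw [← hprod, natDegree_multiset_prod_of_monic _ fun P hP => (hm P hP).2.1,
      Finset.sum_multiset_map_count]
    simp only [smul_eq_mul]
    refine Finset.sum_subset ?_ ?_
    · intro P hP
      obtain ⟨hi, hmon, hdvd⟩ := hm P (Multiset.mem_toFinset.1 hP)
      simp only [Finset.mem_image, Finset.mem_sigma, mem_irreds, Finset.mem_Icc]
      exact ⟨⟨P.natDegree, P⟩,
        ⟨⟨hi.natDegree_pos, natDegree_le_of_dvd hdvd hh.ne_zero⟩, ⟨hmon, rfl⟩, hi⟩, rfl⟩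
    · intro P _ hP
      rw [Multiset.mem_toFinset] at hP
      rw [Multiset.count_eq_zero_of_notMem hP, zero_mul]
  conv_lhs => rw [e1]
  refine Finset.sum_congr rfl fun e he => Finset.sum_congr rfl fun P hP => ?_
  rw [mem_irreds] at hP
  rw [count_normalizedFactors_eq_sum hh hP.1.1 hP.2 hD, hP.1.2, Finset.sum_mul]
  simp only [ite_mul, one_mul, zero_mul]

variable (F) in
/-- The monic polynomials of degree `d` with exactly `r` irreducible factors of degree at most `j`,
counted with multiplicity. -/
noncomputable def layer (j r d : ℕ) : Finset F[X] := (monics F d).filter (smallOmega j · = r)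

@[simp] theorem mem_layer {j r d : ℕ} {h : F[X]} :
    h ∈ layer F j r d ↔ (h.Monic ∧ h.natDegree = d) ∧ smallOmega j h = r := by
  simp [layer]

open Classical in
theorem card_layer_filter_dvd_le {j r d i e s : ℕ} {P : F[X]} (hP : P ∈ irreds F e)
    (hs : s = if e ≤ j then i else 0) :
    ((layer F j r d).filter (P ^ i ∣ ·)).card ≤
      if i * e ≤ d ∧ s ≤ r then (layer F j (r - s) (d - i * e)).card else 0 := by
  rw [mem_irreds] at hP
  obtain ⟨⟨hPm, hPe⟩, hPi⟩ := hP
  have hsub : ∀ h ∈ (layer F j r d).filter (P ^ i ∣ ·), (i * e ≤ d ∧ s ≤ r) ∧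
      h ∈ (layer F j (r - s) (d - i * e)).image (P ^ i * ·) := by
    intro h hh
    rw [Finset.mem_filter, mem_layer] at hh
    obtain ⟨⟨⟨hm, hd⟩, ho⟩, g, rfl⟩ := hh
    have hgm : g.Monic := (hPm.pow i).of_mul_monic_left hm
    rw [(hPm.pow i).natDegree_mul hgm, natDegree_pow, hPe] at hd
    rw [smallOmega_mul j (hPm.pow i).ne_zero hgm.ne_zero, smallOmega_irreducible_pow j hPi, hPe,
      ← hs] at ho
    refine ⟨by omega, Finset.mem_image.2 ⟨g, ?_, rfl⟩⟩
    rw [mem_layer]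
    exact ⟨⟨hgm, by omega⟩, by omega⟩
  split_ifs with hc
  · exact (Finset.card_le_card fun h hh => (hsub h hh).2).trans Finset.card_image_le
  · rw [Nat.le_zero, Finset.card_eq_zero, Finset.eq_empty_iff_forall_notMem]
    exact fun h hh => hc (hsub h hh).1

theorem succ_mul_card_layer_le (j r d : ℕ) :
    (r + 1) * (layer F j (r + 1) d).card ≤ ∑ i ∈ Finset.range (r + 1), ∑ e ∈ Finset.Icc 1 j,
      if (i + 1) * e ≤ d then (irreds F e).card * (layer F j (r - i) (d - (i + 1) * e)).card
      else 0 := by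
  classical
  calc (r + 1) * (layer F j (r + 1) d).card = ∑ h ∈ layer F j (r + 1) d, smallOmega j h := by
        rw [Finset.sum_congr rfl fun h hh => (mem_layer.1 hh).2, Finset.sum_const, smul_eq_mul,
          mul_comm]
    _ = ∑ h ∈ layer F j (r + 1) d, ∑ e ∈ Finset.Icc 1 j, ∑ P ∈ irreds F e,
          ∑ i ∈ Finset.range (d + (r + 1)), if P ^ (i + 1) ∣ h then 1 else 0 := by
        refine Finset.sum_congr rfl fun h hh => ?_
        rw [mem_layer] at hh
        exact smallOmega_eq_sum hh.1.1 (by omega)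
    _ = ∑ i ∈ Finset.range (d + (r + 1)), ∑ e ∈ Finset.Icc 1 j, ∑ P ∈ irreds F e,
          ((layer F j (r + 1) d).filter (P ^ (i + 1) ∣ ·)).card := by
        rw [Finset.sum_comm, Finset.sum_comm (s := Finset.range _)]
        refine Finset.sum_congr rfl fun e _ => ?_
        rw [Finset.sum_comm, Finset.sum_comm (s := Finset.range _)]
        refine Finset.sum_congr rfl fun P _ => ?_
        rw [Finset.sum_comm]
        exact Finset.sum_congr rfl fun i _ => (Finset.card_filter _ _).symm
    _ ≤ ∑ i ∈ Finset.range (d + (r + 1)), ∑ e ∈ Finset.Icc 1 j, ∑ P ∈ irreds F e,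
          if (i + 1) * e ≤ d ∧ i + 1 ≤ r + 1 then
            (layer F j (r + 1 - (i + 1)) (d - (i + 1) * e)).card else 0 := by
        refine Finset.sum_le_sum fun i _ => Finset.sum_le_sum fun e he =>
          Finset.sum_le_sum fun P hP => ?_
        exact card_layer_filter_dvd_le hP (by rw [if_pos (Finset.mem_Icc.1 he).2])
    _ = ∑ i ∈ Finset.range (r + 1), ∑ e ∈ Finset.Icc 1 j, ∑ P ∈ irreds F e,
          if (i + 1) * e ≤ d ∧ i + 1 ≤ r + 1 then
            (layer F j (r + 1 - (i + 1)) (d - (i + 1) * e)).card else 0 := by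
        symm
        refine Finset.sum_subset (Finset.range_mono (by omega)) fun i _ hi => ?_
        rw [Finset.mem_range] at hi
        exact Finset.sum_eq_zero fun e _ => Finset.sum_eq_zero fun P _ => if_neg (by omega)
    _ = _ := by
        refine Finset.sum_congr rfl fun i hi => Finset.sum_congr rfl fun e _ => ?_
        rw [Finset.mem_range] at hi
        rw [Finset.sum_const, smul_eq_mul, mul_ite, mul_zero, Nat.add_sub_add_right]
        exact if_congr (by omega) rfl rfl

theorem natDegree_mul_card_layer_le (j r d : ℕ) :
    d * (layer F j r d).card ≤
      (∑ e ∈ Finset.Ioc j d, Fintype.card F ^ e * (layer F j r (d - e)).card) +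
      ∑ i ∈ Finset.range r, ∑ e ∈ Finset.Icc 1 j,
        if (i + 1) * e ≤ d then
          Fintype.card F ^ e * (layer F j (r - (i + 1)) (d - (i + 1) * e)).card else 0 := by
  classical
  set q := Fintype.card F
  set L : ℕ → ℕ → ℕ := fun s x => (layer F j s x).card
  set g : ℕ → ℕ → ℕ := fun e i => e * (irreds F e).card *
    if (i + 1) * e ≤ d ∧ (if e ≤ j then i + 1 else 0) ≤ r then
      L (r - if e ≤ j then i + 1 else 0) (d - (i + 1) * e) else 0
  have hq : ∀ e, 1 ≤ e → e * (irreds F e).card ≤ q ^ e := fun e he => by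
    simpa using sum_dvd_mul_card_irreds_le F he {e} (by simp)
  have htotal : d * L r d ≤ ∑ e ∈ Finset.Icc 1 d, ∑ i ∈ Finset.range (d + r), g e i := by
    calc d * L r d = ∑ h ∈ layer F j r d, h.natDegree := by
          rw [Finset.sum_congr rfl fun h hh => (mem_layer.1 hh).1.2, Finset.sum_const, smul_eq_mul,
            mul_comm]
      _ = ∑ h ∈ layer F j r d, ∑ e ∈ Finset.Icc 1 d, ∑ P ∈ irreds F e,
            ∑ i ∈ Finset.range (d + r), if P ^ (i + 1) ∣ h then e else 0 := by
          refine Finset.sum_congr rfl fun h hh => ?_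
          obtain ⟨⟨hm, rfl⟩, -⟩ := mem_layer.1 hh
          exact natDegree_eq_sum hm (by omega)
      _ = ∑ e ∈ Finset.Icc 1 d, ∑ i ∈ Finset.range (d + r), ∑ P ∈ irreds F e,
            e * ((layer F j r d).filter (P ^ (i + 1) ∣ ·)).card := by
          rw [Finset.sum_comm]
          refine Finset.sum_congr rfl fun e _ => ?_
          rw [Finset.sum_comm, Finset.sum_comm (s := Finset.range _)]
          refine Finset.sum_congr rfl fun P _ => ?_
          rw [Finset.sum_comm]
          refine Finset.sum_congr rfl fun i _ => ?_
          rw [← Finset.sum_filter, Finset.sum_const, smul_eq_mul, mul_comm]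
      _ ≤ _ := by
          refine Finset.sum_le_sum fun e _ => Finset.sum_le_sum fun i _ => ?_
          simp only [g]
          rw [mul_comm e, mul_assoc, ← smul_eq_mul (irreds F e).card, ← Finset.sum_const]
          exact Finset.sum_le_sum fun P hP =>
            Nat.mul_le_mul_left e (card_layer_filter_dvd_le hP rfl)
  have hsmall : ∑ e ∈ (Finset.Icc 1 d).filter (· ≤ j), ∑ i ∈ Finset.range (d + r), g e i ≤
      ∑ i ∈ Finset.range r, ∑ e ∈ Finset.Icc 1 j,
        if (i + 1) * e ≤ d then q ^ e * L (r - (i + 1)) (d - (i + 1) * e) else 0 := by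
    rw [Finset.sum_comm (s := Finset.range r)]
    refine (Finset.sum_le_sum_of_subset (t := Finset.Icc 1 j) ?_).trans
      (Finset.sum_le_sum fun e he => ?_)
    · intro e he
      simp only [Finset.mem_filter, Finset.mem_Icc] at he ⊢
      omega
    · rw [Finset.mem_Icc] at he
      have : ∑ i ∈ Finset.range (d + r), g e i = ∑ i ∈ Finset.range r, g e i := by
        symm
        refine Finset.sum_subset (Finset.range_mono (by omega)) fun i _ hi => ?_
        rw [Finset.mem_range] at hi
        simp only [g, if_pos he.2]
        rw [if_neg (by omega), mul_zero]
      rw [this]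
      refine Finset.sum_le_sum fun i hi => ?_
      rw [Finset.mem_range] at hi
      simp only [g, if_pos he.2]
      by_cases hc : (i + 1) * e ≤ d
      · rw [if_pos ⟨hc, hi⟩, if_pos hc]
        exact Nat.mul_le_mul_right _ (hq e he.1)
      · rw [if_neg (fun h => hc h.1), if_neg hc, mul_zero]
  have hbig : ∑ e ∈ (Finset.Icc 1 d).filter (¬ · ≤ j), ∑ i ∈ Finset.range (d + r), g e i ≤
      ∑ e ∈ Finset.Ioc j d, q ^ e * L r (d - e) := by
    have hset : (Finset.Icc 1 d).filter (¬ · ≤ j) = Finset.Ioc j d := by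
      ext e
      simp only [Finset.mem_filter, Finset.mem_Icc, Finset.mem_Ioc]
      omega
    rw [hset]
    calc _ ≤ ∑ e ∈ Finset.Ioc j d, ∑ E ∈ Finset.Ioc j d,
          L r (d - E) * if e ∣ E then e * (irreds F e).card else 0 := by
          refine Finset.sum_le_sum fun e he => ?_
          rw [Finset.mem_Ioc] at he
          have h1 := sum_ite_mul_le (f := fun x => L r (d - x)) (fun _ => Nat.zero_le _)
            (show 1 ≤ e by omega) ((Finset.range (d + r)).image (· + 1)) (by simp) d
          rw [Finset.sum_image (by simp)] at h1
          have h2 : ∑ E ∈ Finset.Icc 1 d, (if e ∣ E then L r (d - E) else 0) =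
              ∑ E ∈ Finset.Ioc j d, if e ∣ E then L r (d - E) else 0 := by
            symm
            refine Finset.sum_subset ?_ fun E hE hE' => if_neg fun hdvd => hE' ?_
            · intro E hE
              simp only [Finset.mem_Ioc, Finset.mem_Icc] at hE ⊢
              omega
            · rw [Finset.mem_Icc] at hE
              have := Nat.le_of_dvd hE.1 hdvd
              rw [Finset.mem_Ioc]
              omega
          rw [h2] at h1
          calc ∑ i ∈ Finset.range (d + r), g e i = e * (irreds F e).card *
                ∑ i ∈ Finset.range (d + r),
                  if e * (i + 1) ≤ d then L r (d - e * (i + 1)) else 0 := by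
                rw [Finset.mul_sum]
                refine Finset.sum_congr rfl fun i _ => ?_
                simp only [g, if_neg (show ¬ e ≤ j by omega), Nat.zero_le, and_true, Nat.sub_zero,
                  mul_comm e (i + 1)]
            _ ≤ _ := Nat.mul_le_mul_left _ h1
            _ = _ := by
                rw [Finset.mul_sum]
                refine Finset.sum_congr rfl fun E _ => ?_
                split_ifs
                · exact mul_comm _ _
                · simp
      _ ≤ _ := by
          rw [Finset.sum_comm]
          refine Finset.sum_le_sum fun E hE => ?_
          rw [Finset.mem_Ioc] at hE
          rw [← Finset.mul_sum, mul_comm, ← Finset.sum_filter]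
          exact Nat.mul_le_mul_right _ (sum_dvd_mul_card_irreds_le F (by omega) _
            fun x hx => (Finset.mem_filter.1 hx).2)
  rw [← Finset.sum_filter_add_sum_filter_not (Finset.Icc 1 d) (· ≤ j)] at htotal
  exact htotal.trans ((add_le_add hsmall hbig).trans_eq (add_comm _ _))

variable (F) in
/-- The proportion of monic polynomials of degree `d` lying in `layer F j r d`. -/
noncomputable def layerDensity (j r d : ℕ) : ℝ :=
  (layer F j r d).card / (Fintype.card F : ℝ) ^ d

theorem layerDensity_nonneg (j r d : ℕ) : 0 ≤ layerDensity F j r d := by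
  unfold layerDensity; positivity

theorem layerDensity_le {j d : ℕ} (hj : 1 ≤ j) (hd : 1 ≤ d) (hjd : j ≤ 2 * d) (r : ℕ) :
    layerDensity F j r d ≤ 21 / j * cappedPoisson (Real.log j + 7) r := by
  have hq2 : (2 : ℝ) ≤ Fintype.card F := by exact_mod_cast Fintype.one_lt_card (α := F)
  have hq0 : (0 : ℝ) < Fintype.card F := by linarith
  have hqi : (Fintype.card F : ℝ)⁻¹ ≤ 1 / 2 := by
    rw [one_div]; exact inv_anti₀ (by norm_num) hq2
  refine density_le_cappedPoisson (A := layerDensity F j) (fun _ _ => layerDensity_nonneg _ _ _)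
    hj ?_ ?_ ?_ hd hjd r
  · have : (layer F j 0 0).card ≤ 1 := by
      refine (Finset.card_le_card (Finset.filter_subset _ _)).trans ?_
      rw [card_monics, pow_zero]
    unfold layerDensity
    rw [pow_zero, div_one]
    exact_mod_cast this
  · intro r d
    have h : ((r : ℝ) + 1) * (layer F j (r + 1) d).card ≤ ∑ i ∈ Finset.range (r + 1),
        ∑ e ∈ Finset.Icc 1 j, if (i + 1) * e ≤ d then
          ((irreds F e).card : ℝ) * (layer F j (r - i) (d - (i + 1) * e)).card else 0 := by
      exact_mod_cast succ_mul_card_layer_le (F := F) j r d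
    rw [layerDensity, ← mul_div_assoc, div_le_iff₀ (by positivity), Finset.sum_mul]
    refine h.trans (Finset.sum_le_sum fun i _ => ?_)
    rw [Finset.sum_mul]
    refine Finset.sum_le_sum fun e he => ?_
    rw [Finset.mem_Icc] at he
    split_ifs with hc
    · have hsplit : (Fintype.card F : ℝ) ^ d = (Fintype.card F : ℝ) ^ (d - (i + 1) * e) *
          ((Fintype.card F : ℝ) ^ (i * e) * (Fintype.card F : ℝ) ^ e) := by
        rw [← pow_add, ← pow_add]; congr 1
        have : (i + 1) * e = i * e + e := by ring
        omega
      have h1 := card_irreds_div_le F he.1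
      rw [div_le_iff₀ (by positivity)] at h1
      have h2 : (1 : ℝ) ≤ (1 / 2) ^ (i * e) * (Fintype.card F : ℝ) ^ (i * e) := by
        rw [← mul_pow]; exact one_le_pow₀ (by linarith)
      unfold layerDensity
      rw [hsplit]
      have h3 : (1 / e : ℝ) * (1 / 2) ^ (i * e) *
          (((layer F j (r - i) (d - (i + 1) * e)).card : ℝ) /
          (Fintype.card F : ℝ) ^ (d - (i + 1) * e)) * ((Fintype.card F : ℝ) ^ (d - (i + 1) * e) *
          ((Fintype.card F : ℝ) ^ (i * e) * (Fintype.card F : ℝ) ^ e)) =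
          (1 / e * (Fintype.card F : ℝ) ^ e) *
            (((1 / 2) ^ (i * e) * (Fintype.card F : ℝ) ^ (i * e)) *
            (layer F j (r - i) (d - (i + 1) * e)).card) := by
        field_simp
      rw [h3]
      refine mul_le_mul h1 (le_mul_of_one_le_left (by positivity) h2) (by positivity)
        (by positivity)
    · simp
  · intro r d
    have h : (d : ℝ) * (layer F j r d).card ≤
        (∑ e ∈ Finset.Ioc j d, (Fintype.card F : ℝ) ^ e * (layer F j r (d - e)).card) +
        ∑ i ∈ Finset.range r, ∑ e ∈ Finset.Icc 1 j, if (i + 1) * e ≤ d then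
          (Fintype.card F : ℝ) ^ e * (layer F j (r - (i + 1)) (d - (i + 1) * e)).card else 0 := by
      exact_mod_cast natDegree_mul_card_layer_le (F := F) j r d
    rw [layerDensity, ← mul_div_assoc, div_le_iff₀ (by positivity), add_mul, Finset.sum_mul,
      Finset.sum_mul]
    refine h.trans (add_le_add (Finset.sum_le_sum fun e he => ?_) (Finset.sum_le_sum fun i _ => ?_))
    · rw [Finset.mem_Ioc] at he
      have : (Fintype.card F : ℝ) ^ d =
          (Fintype.card F : ℝ) ^ (d - e) * (Fintype.card F : ℝ) ^ e := by
        rw [← pow_add]; congr 1; omega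
      rw [layerDensity, this, ← mul_assoc, div_mul_cancel₀ _ (by positivity), mul_comm]
    · rw [Finset.mul_sum, Finset.sum_mul]
      refine Finset.sum_le_sum fun e he => ?_
      rw [Finset.mem_Icc] at he
      split_ifs with hc
      · have hsplit : (Fintype.card F : ℝ) ^ d = (Fintype.card F : ℝ) ^ (d - (i + 1) * e) *
            ((Fintype.card F : ℝ) ^ (i * e) * (Fintype.card F : ℝ) ^ e) := by
          rw [← pow_add, ← pow_add]; congr 1
          have : (i + 1) * e = i * e + e := by ring
          omega
        have h2 : (1 : ℝ) ≤ (1 / 2) ^ i * (Fintype.card F : ℝ) ^ (i * e) := by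
          have : (Fintype.card F : ℝ) ^ i ≤ (Fintype.card F : ℝ) ^ (i * e) :=
            pow_le_pow_right₀ (by linarith) (Nat.le_mul_of_pos_right i he.1)
          calc (1 : ℝ) ≤ (1 / 2 * (Fintype.card F : ℝ)) ^ i := one_le_pow₀ (by linarith)
            _ = (1 / 2) ^ i * (Fintype.card F : ℝ) ^ i := mul_pow _ _ _
            _ ≤ _ := mul_le_mul_of_nonneg_left this (by positivity)
        unfold layerDensity
        rw [hsplit]
        have h3 : (1 / 2 : ℝ) ^ i * (((layer F j (r - (i + 1)) (d - (i + 1) * e)).card : ℝ) /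
            (Fintype.card F : ℝ) ^ (d - (i + 1) * e)) * ((Fintype.card F : ℝ) ^ (d - (i + 1) * e) *
            ((Fintype.card F : ℝ) ^ (i * e) * (Fintype.card F : ℝ) ^ e)) =
            ((1 / 2) ^ i * (Fintype.card F : ℝ) ^ (i * e)) * ((Fintype.card F : ℝ) ^ e *
              (layer F j (r - (i + 1)) (d - (i + 1) * e)).card) := by
          field_simp
        rw [h3]
        exact le_mul_of_one_le_left (by positivity) h2
      · simp

end Counting

theorem sum_range_pow_div_factorial_le {x : ℝ} (hx : 0 ≤ x) {R : ℕ} (hR : (R : ℝ) ≤ 3 / 4 * x) :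
    ∑ r ∈ Finset.range (R + 1), x ^ r / r.factorial ≤ 4 * (x ^ R / R.factorial) := by
  induction R with
  | zero => simp
  | succ R ih =>
    push_cast at hR
    have h0 : 0 ≤ x ^ R / R.factorial := by positivity
    have h : x ^ R / R.factorial ≤ 3 / 4 * (x ^ (R + 1) / (R + 1).factorial) := by
      have e : x ^ (R + 1) / ((R + 1).factorial : ℝ) = x ^ R / R.factorial * (x / (R + 1)) := by
        rw [Nat.factorial_succ]; push_cast; field_simp; ring
      have : 4 / 3 ≤ x / (R + 1) := by rw [le_div_iff₀ (by positivity)]; linarith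
      rw [e]
      nlinarith
    rw [Finset.sum_range_succ]
    linarith [ih (by linarith)]

theorem sum_antidiagonal_pow_div_factorial (x : ℝ) (r : ℕ) :
    ∑ p ∈ Finset.HasAntidiagonal.antidiagonal r,
        (x ^ p.1 / p.1.factorial) * (x ^ p.2 / p.2.factorial) =
      (2 * x) ^ r / r.factorial := by
  rw [two_mul, (Commute.all x x).add_pow', Finset.sum_div]
  refine Finset.sum_congr rfl fun p hp => ?_
  obtain rfl := Finset.HasAntidiagonal.mem_antidiagonal.1 hp
  have h : (((p.1 + p.2).choose p.2 : ℕ) : ℝ) * p.1.factorial * p.2.factorial =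
      (p.1 + p.2).factorial := by
    exact_mod_cast Nat.add_choose_mul_factorial_mul_factorial p.1 p.2
  rw [← h, nsmul_eq_mul, Nat.choose_symm_add]
  have := Nat.choose_pos (Nat.le_add_left p.2 p.1)
  field_simp

section MultiplicationTable

variable (F : Type) [Field F] [Fintype F]

open Classical in
/-- The monic polynomials of degree `m` with a monic divisor of degree `j`. -/
noncomputable def monicsWithDivisor (m j : ℕ) : Finset F[X] :=
  (monics F m).filter fun h => ∃ g ∈ monics F j, g ∣ h

variable {F}

@[simp] theorem mem_monicsWithDivisor {m j : ℕ} {h : F[X]} :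
    h ∈ monicsWithDivisor F m j ↔ (h.Monic ∧ h.natDegree = m) ∧
      ∃ g : F[X], (g.Monic ∧ g.natDegree = j) ∧ g ∣ h := by
  simp [monicsWithDivisor]

variable (F) in
theorem card_monicsWithDivisor_div_le (m j R : ℕ) :
    ((monicsWithDivisor F m j).card : ℝ) / (Fintype.card F : ℝ) ^ m ≤
      ∑ r ∈ Finset.Ioc R m, layerDensity F j r m +
      ∑ r ∈ Finset.range (R + 1), ∑ p ∈ Finset.HasAntidiagonal.antidiagonal r,
        layerDensity F j p.1 j * layerDensity F j p.2 (m - j) := by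
  classical
  have hq0 : (0 : ℝ) < Fintype.card F := by exact_mod_cast Fintype.card_pos
  rcases lt_or_ge m j with hmj | hmj
  · have : monicsWithDivisor F m j = ∅ := by
      refine Finset.eq_empty_iff_forall_notMem.2 fun h hh => ?_
      obtain ⟨⟨hm, rfl⟩, g, ⟨-, rfl⟩, hdvd⟩ := mem_monicsWithDivisor.1 hh
      exact absurd (natDegree_le_of_dvd hdvd hm.ne_zero) (by omega)
    rw [this, Finset.card_empty, Nat.cast_zero, zero_div]
    exact add_nonneg (Finset.sum_nonneg fun _ _ => layerDensity_nonneg _ _ _)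
      (Finset.sum_nonneg fun _ _ => Finset.sum_nonneg fun _ _ =>
        mul_nonneg (layerDensity_nonneg _ _ _) (layerDensity_nonneg _ _ _))
  have hsub : monicsWithDivisor F m j ⊆ ((Finset.Ioc R m).biUnion fun r => layer F j r m) ∪
      (Finset.range (R + 1)).biUnion fun r =>
        (Finset.HasAntidiagonal.antidiagonal r).biUnion fun p =>
          (layer F j p.1 j ×ˢ layer F j p.2 (m - j)).image fun x => x.1 * x.2 := by
    intro h hh
    obtain ⟨⟨hm, hd⟩, g, ⟨hg, hgd⟩, f, rfl⟩ := mem_monicsWithDivisor.1 hh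
    have hf : f.Monic := hg.of_mul_monic_left hm
    rw [hg.natDegree_mul hf, hgd] at hd
    have ho := smallOmega_mul j hg.ne_zero hf.ne_zero
    rw [Finset.mem_union]
    rcases lt_or_ge R (smallOmega j (g * f)) with hR | hR
    · left
      rw [Finset.mem_biUnion]
      refine ⟨_, Finset.mem_Ioc.2 ⟨hR, ?_⟩, mem_layer.2 ⟨⟨hm, ?_⟩, rfl⟩⟩
      · refine (smallOmega_le_natDegree j hm).trans ?_
        rw [hg.natDegree_mul hf]; omega
      · rw [hg.natDegree_mul hf]; omega
    · right
      simp only [Finset.mem_biUnion, Finset.mem_range, Finset.HasAntidiagonal.mem_antidiagonal,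
        Finset.mem_image, Finset.mem_product, mem_layer]
      have hfd : f.natDegree = m - j := by omega
      exact ⟨_, Nat.lt_succ_of_le hR, (smallOmega j g, smallOmega j f), ho.symm, (g, f),
        ⟨⟨⟨hg, hgd⟩, rfl⟩, ⟨hf, hfd⟩, rfl⟩, rfl⟩
  have hcard : (monicsWithDivisor F m j).card ≤ ∑ r ∈ Finset.Ioc R m, (layer F j r m).card +
      ∑ r ∈ Finset.range (R + 1), ∑ p ∈ Finset.HasAntidiagonal.antidiagonal r,
        (layer F j p.1 j).card * (layer F j p.2 (m - j)).card := by
    refine (Finset.card_le_card hsub).trans ((Finset.card_union_le _ _).trans ?_)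
    refine add_le_add Finset.card_biUnion_le (Finset.card_biUnion_le.trans ?_)
    refine Finset.sum_le_sum fun r _ => Finset.card_biUnion_le.trans ?_
    exact Finset.sum_le_sum fun p _ => Finset.card_image_le.trans (Finset.card_product _ _).le
  have hcard' : ((monicsWithDivisor F m j).card : ℝ) ≤
      ∑ r ∈ Finset.Ioc R m, ((layer F j r m).card : ℝ) +
      ∑ r ∈ Finset.range (R + 1), ∑ p ∈ Finset.HasAntidiagonal.antidiagonal r,
        ((layer F j p.1 j).card : ℝ) * (layer F j p.2 (m - j)).card := by
    exact_mod_cast hcard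
  have hsplit : (Fintype.card F : ℝ) ^ m =
      (Fintype.card F : ℝ) ^ j * (Fintype.card F : ℝ) ^ (m - j) := by
    rw [← pow_add]; congr 1; omega
  rw [div_le_iff₀ (by positivity), add_mul, Finset.sum_mul, Finset.sum_mul]
  refine hcard'.trans_eq ?_
  congr 1
  · refine Finset.sum_congr rfl fun r _ => ?_
    rw [layerDensity, div_mul_cancel₀ _ (by positivity)]
  · refine Finset.sum_congr rfl fun r _ => ?_
    rw [Finset.sum_mul]
    refine Finset.sum_congr rfl fun p _ => ?_
    rw [layerDensity, layerDensity, hsplit]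
    field_simp

variable (F) in
theorem card_monicsWithDivisor_le_poisson {m j R : ℕ} (hj : 2 ≤ j) (hjm : 2 * j ≤ m + 1)
    (hR : 2 ^ R ≤ j) (hR1 : Real.log j + 7 ≤ 4 / 5 * (R + 1))
    (hR2 : (R : ℝ) ≤ 3 / 2 * (Real.log j + 7)) :
    ((monicsWithDivisor F m j).card : ℝ) / (Fintype.card F : ℝ) ^ m ≤
      1869 / j * ((Real.log j + 7) ^ R / R.factorial) := by
  have hj0 : (0 : ℝ) < j := by exact_mod_cast (by omega : 0 < j)
  have hlog : 0 ≤ Real.log j := Real.log_natCast_nonneg j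
  set Λ := Real.log j + 7 with hΛ
  have hΛ0 : 0 ≤ Λ := by positivity
  refine (card_monicsWithDivisor_div_le F m j R).trans ?_
  have hT : cappedPoisson Λ R = Λ ^ R / R.factorial := cappedPoisson_eq hR2
  have h1 : ∑ r ∈ Finset.Ioc R m, layerDensity F j r m ≤ 105 / j * (Λ ^ R / R.factorial) := by
    calc _ ≤ ∑ r ∈ Finset.Ioc R m, 21 / j * cappedPoisson Λ r :=
          Finset.sum_le_sum fun r _ => layerDensity_le (by omega) (by omega) (by omega) r
      _ ≤ 21 / j * (5 * cappedPoisson Λ R) := by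
          rw [← Finset.mul_sum]
          exact mul_le_mul_of_nonneg_left (sum_cappedPoisson_Ioc_le hR1 m) (by positivity)
      _ = _ := by rw [hT]; ring
  have h2 : ∑ r ∈ Finset.range (R + 1), ∑ p ∈ Finset.HasAntidiagonal.antidiagonal r,
      layerDensity F j p.1 j * layerDensity F j p.2 (m - j) ≤
      1764 / j * (Λ ^ R / R.factorial) := by
    calc _ ≤ ∑ r ∈ Finset.range (R + 1), (21 / j) ^ 2 * ((2 * Λ) ^ r / r.factorial) := by
          refine Finset.sum_le_sum fun r hr => ?_
          rw [← sum_antidiagonal_pow_div_factorial, Finset.mul_sum]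
          refine Finset.sum_le_sum fun p hp => ?_
          rw [Finset.HasAntidiagonal.mem_antidiagonal] at hp
          rw [Finset.mem_range] at hr
          have hp1 : (p.1 : ℝ) ≤ 3 / 2 * Λ :=
            le_trans (by exact_mod_cast (by omega : p.1 ≤ R)) hR2
          have hp2 : (p.2 : ℝ) ≤ 3 / 2 * Λ :=
            le_trans (by exact_mod_cast (by omega : p.2 ≤ R)) hR2
          have a1 := layerDensity_le (F := F) (show 1 ≤ j by omega) (show 1 ≤ j by omega)
            (by omega) p.1
          have a2 := layerDensity_le (F := F) (show 1 ≤ j by omega) (show 1 ≤ m - j by omega)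
            (by omega) p.2
          rw [← hΛ, cappedPoisson_eq hp1] at a1
          rw [← hΛ, cappedPoisson_eq hp2] at a2
          refine (mul_le_mul a1 a2 (layerDensity_nonneg _ _ _) (by positivity)).trans_eq ?_
          ring
      _ ≤ (21 / j) ^ 2 * (4 * ((2 * Λ) ^ R / R.factorial)) := by
          rw [← Finset.mul_sum]
          refine mul_le_mul_of_nonneg_left (sum_range_pow_div_factorial_le (by positivity) ?_)
            (by positivity)
          linarith
      _ = 1764 / j * (Λ ^ R / R.factorial) * (2 ^ R / j) := by
          rw [mul_pow]; ring
      _ ≤ _ := by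
          refine mul_le_of_le_one_right (by positivity) ?_
          rw [div_le_one hj0]
          exact_mod_cast hR
  calc _ ≤ 105 / j * (Λ ^ R / R.factorial) + 1764 / j * (Λ ^ R / R.factorial) := add_le_add h1 h2
    _ = _ := by ring

theorem pow_div_factorial_le_ford {j R : ℕ} (hj : 50 ≤ Real.log j)
    (hR1 : R * Real.log 2 ≤ Real.log j) (hR2 : Real.log j ≤ (R + 1) * Real.log 2) :
    (Real.log j + 7) ^ R / R.factorial ≤
      Real.exp 12 * (j * (j : ℝ) ^ (-fordDelta) * (1 + Real.log j) ^ (-(1 / 2) : ℝ)) := by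
  set y := Real.log j with hy
  set l := Real.log 2 with hl
  have hl1 : 0.69 < l := by have := Real.log_two_gt_d9; linarith
  have hl2 : l < 0.7 := by have := Real.log_two_lt_d9; linarith
  have hl0 : 0 < l := by linarith
  have hj0 : (0 : ℝ) < j := by
    rcases Nat.eq_zero_or_pos j with rfl | h
    · norm_num [hy] at hj
    · exact_mod_cast h
  have hRy : 1 + y ≤ R := by nlinarith
  have hR0 : (0 : ℝ) < R := by linarith
  have hyR : R ≤ 3 / 2 * y := by nlinarith
  have hstir : √R * (R / Real.exp 1) ^ R ≤ (R.factorial : ℝ) := by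
    refine le_trans ?_ (Stirling.le_factorial_stirling R)
    refine mul_le_mul_of_nonneg_right (Real.sqrt_le_sqrt ?_) (by positivity)
    nlinarith [Real.pi_gt_three]
  have hlogΛ : Real.log (y + 7) ≤ Real.log R + 1 / R + Real.log l + 7 / y := by
    have h1 : y + 7 = y * (1 + 7 / y) := by field_simp
    have h2 : Real.log (1 + 7 / y) ≤ 7 / y := by
      have := Real.log_le_sub_one_of_pos (show 0 < 1 + 7 / y by positivity); linarith
    have h3 : Real.log (1 + 1 / R) ≤ 1 / R := by
      have := Real.log_le_sub_one_of_pos (show (0 : ℝ) < 1 + 1 / R by positivity); linarith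
    have h4 : Real.log y ≤ Real.log R + Real.log (1 + 1 / R) + Real.log l := by
      rw [← Real.log_mul (by positivity) (by positivity),
        ← Real.log_mul (by positivity) (by positivity)]
      refine Real.log_le_log (by linarith) (hR2.trans_eq ?_)
      field_simp
    rw [h1, Real.log_mul (by positivity) (by positivity)]
    linarith
  have hl1' : 0 ≤ 1 + Real.log l := by
    have : Real.exp (-1) ≤ l := by
      rw [Real.exp_neg, inv_le_comm₀ (Real.exp_pos _) hl0]
      have h1 := Real.exp_one_gt_d9
      have h2 : l⁻¹ ≤ 2 := by rw [inv_le_comm₀ hl0 (by norm_num)]; linarith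
      linarith
    have := (Real.le_log_iff_exp_le hl0).2 this
    linarith
  have hexp : (R : ℝ) * (1 + Real.log (y + 7) - Real.log R) ≤ (1 - fordDelta) * y + 12 := by
    have h1 : (R : ℝ) * (1 + Real.log (y + 7) - Real.log R) ≤
        R * (1 + Real.log l + 1 / R + 7 / y) :=
      mul_le_mul_of_nonneg_left (by linarith) hR0.le
    have h2 : (R : ℝ) * (1 + Real.log l + 1 / R + 7 / y) =
        R * (1 + Real.log l) + 1 + 7 * (R / y) := by field_simp
    have h3 : (R : ℝ) / y ≤ 3 / 2 := by rw [div_le_iff₀ (by linarith)]; exact hyR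
    have h4 : (R : ℝ) * (1 + Real.log l) ≤ y / l * (1 + Real.log l) :=
      mul_le_mul_of_nonneg_right (by rw [le_div_iff₀ hl0]; exact hR1) hl1'
    have h5 : (1 - fordDelta) * y = y / l * (1 + Real.log l) := by
      rw [fordDelta, ← hl]; ring
    linarith
  have hpow : (y + 7) ^ R = (R / Real.exp 1) ^ R *
      Real.exp (R * (1 + Real.log (y + 7) - Real.log R)) := by
    rw [mul_comm (R : ℝ) (1 + _ - _), mul_comm (_ - _) (R : ℝ), Real.exp_nat_mul, ← mul_pow]
    congr 1
    rw [Real.exp_sub, Real.exp_add, Real.exp_log (by linarith), Real.exp_log hR0]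
    field_simp
  have hsqrt : (√R)⁻¹ ≤ (1 + y) ^ (-(1 / 2) : ℝ) := by
    rw [Real.rpow_neg (by linarith), ← Real.sqrt_eq_rpow]
    exact inv_anti₀ (Real.sqrt_pos.2 (by linarith)) (Real.sqrt_le_sqrt hRy)
  have hjd : (j : ℝ) * (j : ℝ) ^ (-fordDelta) = Real.exp ((1 - fordDelta) * y) := by
    rw [hy, mul_comm (1 - fordDelta), ← Real.rpow_def_of_pos hj0, sub_eq_add_neg,
      Real.rpow_add hj0, Real.rpow_one]
  calc (y + 7) ^ R / R.factorial ≤ (y + 7) ^ R / (√R * (R / Real.exp 1) ^ R) :=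
        div_le_div_of_nonneg_left (by positivity) (by positivity) hstir
    _ = Real.exp (R * (1 + Real.log (y + 7) - Real.log R)) * (√R)⁻¹ := by
        rw [hpow]; field_simp
    _ ≤ Real.exp ((1 - fordDelta) * y + 12) * (1 + y) ^ (-(1 / 2) : ℝ) :=
        mul_le_mul (Real.exp_le_exp.2 hexp) hsqrt (by positivity) (by positivity)
    _ = _ := by rw [hjd, Real.exp_add]; ring

variable (F) in
/-- The multiplication table bound for monic polynomials over a finite field. -/
theorem card_monicsWithDivisor_le {m j : ℕ} (hj : 50 ≤ Real.log j) (hjm : 2 * j ≤ m + 1) :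
    ((monicsWithDivisor F m j).card : ℝ) ≤ 1869 * Real.exp 12 * (Fintype.card F : ℝ) ^ m *
      ((j : ℝ) ^ (-fordDelta) * (1 + Real.log j) ^ (-(1 / 2) : ℝ)) := by
  have hl1 : 0.69 < Real.log 2 := by have := Real.log_two_gt_d9; linarith
  have hl2 : Real.log 2 < 0.7 := by have := Real.log_two_lt_d9; linarith
  have hj2 : 2 ≤ j := by
    by_contra h
    interval_cases j <;> norm_num at hj
  have hj0 : (0 : ℝ) < j := by exact_mod_cast (by omega : 0 < j)
  have hq0 : (0 : ℝ) < Fintype.card F := by exact_mod_cast Fintype.card_pos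
  have hpow := Nat.pow_log_le_self 2 (show j ≠ 0 by omega)
  have hpow' := Nat.lt_pow_succ_log_self (show 1 < 2 by norm_num) j
  set R := Nat.log 2 j
  have hR1 : R * Real.log 2 ≤ Real.log j := by
    rw [← Real.log_pow]
    exact Real.log_le_log (by positivity) (by exact_mod_cast hpow)
  have hR2 : Real.log j ≤ (R + 1) * Real.log 2 := by
    have : ((R : ℝ) + 1) * Real.log 2 = Real.log (2 ^ (R + 1)) := by
      rw [Real.log_pow]; push_cast; ring
    rw [this]
    exact Real.log_le_log hj0 (by exact_mod_cast hpow'.le)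
  have h := card_monicsWithDivisor_le_poisson F hj2 hjm hpow (by nlinarith) (by nlinarith)
  rw [div_le_iff₀ (by positivity)] at h
  refine h.trans ?_
  have h2 := mul_le_mul_of_nonneg_left (pow_div_factorial_le_ford hj hR1 hR2)
    (show 0 ≤ 1869 / (j : ℝ) * (Fintype.card F : ℝ) ^ m by positivity)
  calc _ = 1869 / (j : ℝ) * (Fintype.card F : ℝ) ^ m *
        ((Real.log j + 7) ^ R / R.factorial) := by ring
    _ ≤ _ := h2
    _ = _ := by field_simp

end MultiplicationTable
section StarSymmetric

variable {F : Type} [Field F]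

theorem IsStarSymm.ne_zero {f : F[X]} (hf : IsStarSymm f) : f ≠ 0 := by
  rintro rfl
  exact hf.1 (coeff_zero 0)

theorem IsStarSymm.mul {f g : F[X]} (hf : IsStarSymm f) (hg : IsStarSymm g) :
    IsStarSymm (f * g) := by
  refine ⟨by rw [mul_coeff_zero]; exact mul_ne_zero hf.1 hg.1, ?_⟩
  rw [reverse_mul_of_domain, hf.2, hg.2, mul_coeff_zero, C_mul]
  ring

theorem IsStarSymm.of_mul_left {f g : F[X]} (hf : IsStarSymm f) (hfg : IsStarSymm (f * g)) :
    IsStarSymm g := by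
  obtain ⟨h0, h⟩ := hfg
  rw [mul_coeff_zero] at h0 h
  refine ⟨right_ne_zero_of_mul h0, ?_⟩
  rw [reverse_mul_of_domain, hf.2, C_mul] at h
  have hC : C (f.coeff 0) ≠ 0 := C_ne_zero.2 hf.1
  refine mul_left_cancel₀ (mul_ne_zero hC hf.ne_zero) (h.trans ?_)
  ring

theorem isStarSymm_one : IsStarSymm (1 : F[X]) := by
  have : (1 : F[X]).reverse = 1 := by simpa using reverse_C (1 : F)
  exact ⟨by simp, by simp [this]⟩

theorem IsStarSymm.pow {f : F[X]} (hf : IsStarSymm f) (i : ℕ) : IsStarSymm (f ^ i) := by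
  induction i with
  | zero => simpa using isStarSymm_one
  | succ i ih => rw [pow_succ]; exact ih.mul hf

theorem IsStarSymm.coeff_rev {f : F[X]} (hf : IsStarSymm f) {i : ℕ} (hi : i ≤ f.natDegree) :
    f.coeff (f.natDegree - i) = f.coeff 0 * f.coeff i := by
  rw [← coeff_C_mul, ← hf.2, coeff_reverse, revAt_le hi]

theorem IsStarSymm.coeff_zero_mul_self {f : F[X]} (hf : IsStarSymm f) (hm : f.Monic) :
    f.coeff 0 * f.coeff 0 = 1 := by
  rw [← hf.coeff_rev (Nat.zero_le _), Nat.sub_zero, hm.coeff_natDegree]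

theorem isStarSymm_X_sub_C {ε : F} (hε : ε * ε = 1) : IsStarSymm (X - C ε) := by
  have h0 : ε ≠ 0 := left_ne_zero_of_mul (hε.symm ▸ one_ne_zero)
  have hd : (X - C ε).natDegree = 1 := natDegree_X_sub_C ε
  refine ⟨by simpa using h0, ?_⟩
  have h2 : reflect 1 (X : F[X]) = 1 := by simp
  have h3 : reflect 1 (C ε) = C ε * X := by simp [reflect_C]
  rw [reverse, hd, reflect_sub, h2, h3, coeff_sub, coeff_X_zero, coeff_C_zero, zero_sub, C_neg,
    neg_mul, mul_sub, ← C_mul, hε, C_1]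
  ring

/-- A *-symmetric monic polynomial of odd degree or with constant coefficient other than `1`
vanishes at `1` or at `-1`. -/
theorem IsStarSymm.exists_dvd {f : F[X]} (hf : IsStarSymm f) (hm : f.Monic)
    (h : ¬(Even f.natDegree ∧ f.coeff 0 = 1)) :
    ∃ ε : F, (ε = 1 ∨ ε = -1) ∧ X - C ε ∣ f := by
  have haa := hf.coeff_zero_mul_self hm
  have ha := mul_self_eq_one_iff.1 haa
  simp only [dvd_iff_isRoot, IsRoot, eval_eq_sum_range]
  by_cases hn : Even f.natDegree
  · have ha1 : f.coeff 0 = -1 := ha.resolve_left fun h' => h ⟨hn, h'⟩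
    have h2 : (2 : F) ≠ 0 := by
      intro h2
      refine h ⟨hn, ?_⟩
      rw [ha1]
      linear_combination -h2
    refine ⟨1, Or.inl rfl, ?_⟩
    have key := Finset.sum_range_reflect (fun i => f.coeff i) (f.natDegree + 1)
    have key2 : ∑ i ∈ Finset.range (f.natDegree + 1), f.coeff (f.natDegree + 1 - 1 - i) =
        -∑ i ∈ Finset.range (f.natDegree + 1), f.coeff i := by
      rw [← Finset.sum_neg_distrib]
      refine Finset.sum_congr rfl fun i hi => ?_
      rw [Nat.add_sub_cancel, hf.coeff_rev (Finset.mem_range_succ_iff.1 hi), ha1]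
      ring
    simp only [one_pow, mul_one]
    refine (mul_eq_zero.1 ?_).resolve_left h2
    rw [key2] at key
    linear_combination -key
  · refine ⟨-f.coeff 0, ?_, ?_⟩
    · rcases ha with h | h <;> simp [h]
    have hodd := Nat.not_even_iff_odd.1 hn
    refine Finset.sum_involution (fun i _ => f.natDegree - i) (fun i hi => ?_) (fun i hi _ => ?_)
      (fun i hi => ?_) (fun i hi => ?_)
    · rw [Finset.mem_range_succ_iff] at hi
      rw [hf.coeff_rev hi]
      have h1 : (-f.coeff 0) ^ (f.natDegree - i) * (-f.coeff 0) ^ i = -f.coeff 0 := by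
        rw [← pow_add, Nat.sub_add_cancel hi]
        obtain ⟨t, ht⟩ := hodd
        rw [ht, pow_succ, pow_mul, neg_sq, sq, haa, one_pow, one_mul]
      have h2 : (-f.coeff 0) ^ i * (-f.coeff 0) ^ i = 1 := by
        rw [← mul_pow, neg_mul_neg, haa, one_pow]
      linear_combination (-f.coeff 0 * f.coeff i * (-f.coeff 0) ^ (f.natDegree - i)) * h2 +
        (f.coeff 0 * f.coeff i * (-f.coeff 0) ^ i) * h1 - f.coeff i * (-f.coeff 0) ^ i * haa
    · rw [Finset.mem_range_succ_iff] at hi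
      obtain ⟨t, ht⟩ := hodd
      omega
    · rw [Finset.mem_range_succ_iff]
      omega
    · rw [Finset.mem_range_succ_iff] at hi
      omega

/-- `p` is palindromic with respect to the formal degree `N`. -/
def IsPalindromic (N : ℕ) (p : F[X]) : Prop := p.natDegree ≤ N ∧ reflect N p = p

theorem IsPalindromic.mul {N M : ℕ} {p r : F[X]} (hp : IsPalindromic N p)
    (hr : IsPalindromic M r) : IsPalindromic (N + M) (p * r) :=
  ⟨natDegree_mul_le_of_le hp.1 hr.1, by rw [reflect_mul p r hp.1 hr.1, hp.2, hr.2]⟩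

theorem isPalindromic_one : IsPalindromic 0 (1 : F[X]) :=
  ⟨by simp, by simp⟩

theorem IsPalindromic.pow {N : ℕ} {p : F[X]} (hp : IsPalindromic N p) (i : ℕ) :
    IsPalindromic (N * i) (p ^ i) := by
  induction i with
  | zero => simpa using isPalindromic_one
  | succ i ih => rw [pow_succ, mul_add_one]; exact ih.mul hp

theorem IsPalindromic.C_mul {N : ℕ} {p : F[X]} (hp : IsPalindromic N p) (c : F) :
    IsPalindromic N (C c * p) :=
  ⟨(natDegree_C_mul_le c p).trans hp.1, by rw [reflect_C_mul, hp.2]⟩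

theorem IsPalindromic.add {N : ℕ} {p r : F[X]} (hp : IsPalindromic N p)
    (hr : IsPalindromic N r) : IsPalindromic N (p + r) :=
  ⟨natDegree_add_le_of_degree_le hp.1 hr.1, by rw [reflect_add, hp.2, hr.2]⟩

theorem IsPalindromic.sub {N : ℕ} {p r : F[X]} (hp : IsPalindromic N p)
    (hr : IsPalindromic N r) : IsPalindromic N (p - r) :=
  ⟨(natDegree_sub_le_of_le hp.1 hr.1).trans_eq (max_self N), by rw [reflect_sub, hp.2, hr.2]⟩

theorem isPalindromic_zero (N : ℕ) : IsPalindromic N (0 : F[X]) := ⟨by simp, reflect_zero⟩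

theorem isPalindromic_sum {ι : Type*} {N : ℕ} (s : Finset ι) (p : ι → F[X])
    (h : ∀ i ∈ s, IsPalindromic N (p i)) : IsPalindromic N (∑ i ∈ s, p i) :=
  Finset.sum_induction p _ (fun _ _ => IsPalindromic.add) (isPalindromic_zero N) h

theorem IsPalindromic.coeff_rev {N : ℕ} {p : F[X]} (hp : IsPalindromic N p) {i : ℕ}
    (hi : i ≤ N) : p.coeff (N - i) = p.coeff i := by
  conv_rhs => rw [← hp.2, coeff_reflect, revAt_le hi]

theorem isPalindromic_of_coeff {N : ℕ} {p : F[X]} (hd : p.natDegree ≤ N)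
    (h : ∀ i ≤ N, p.coeff (N - i) = p.coeff i) : IsPalindromic N p := by
  refine ⟨hd, ext fun i => ?_⟩
  rcases le_or_gt i N with hi | hi
  · rw [coeff_reflect, revAt_le hi, h i hi]
  · rw [coeff_reflect, revAt_eq_self_of_lt hi]

theorem isPalindromic_X : IsPalindromic 2 (X : F[X]) :=
  ⟨by simp, by simpa using reflect_monomial (R := F) 2 1⟩

theorem isPalindromic_X_sq_add_one : IsPalindromic 2 (X ^ 2 + 1 : F[X]) := by
  refine ⟨by compute_degree, ?_⟩
  have h : reflect 2 (1 : F[X]) = X ^ 2 := by simp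
  rw [reflect_add, reflect_monomial, h]
  simp [add_comm]

theorem IsPalindromic.isStarSymm {N : ℕ} {p : F[X]} (hp : IsPalindromic N p) (hm : p.Monic)
    (hd : p.natDegree = N) : IsStarSymm p ∧ p.coeff 0 = 1 := by
  have h0 : p.coeff 0 = 1 := by
    rw [← hp.coeff_rev (Nat.zero_le _), Nat.sub_zero, ← hd, hm.coeff_natDegree]
  refine ⟨⟨by rw [h0]; exact one_ne_zero, ?_⟩, h0⟩
  rw [reverse, hd, hp.2, h0, C_1, one_mul]

theorem IsStarSymm.isPalindromic {f : F[X]} (hf : IsStarSymm f) (h : f.coeff 0 = 1) :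
    IsPalindromic f.natDegree f := by
  refine ⟨le_rfl, ?_⟩
  have := hf.2
  rwa [h, C_1, one_mul] at this

/-- The polynomial `X ^ m * h (X + 1 / X)`, for `h` of degree at most `m`. -/
noncomputable def symLift (m : ℕ) (h : F[X]) : F[X] :=
  ∑ i ∈ Finset.range (m + 1), C (h.coeff i) * ((X ^ 2 + 1) ^ i * X ^ (m - i))

theorem isPalindromic_symLift (m : ℕ) (h : F[X]) : IsPalindromic (2 * m) (symLift m h) := by
  refine isPalindromic_sum _ _ fun i hi => ?_
  rw [Finset.mem_range_succ_iff] at hi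
  have h2 : 2 * m = 2 * i + 2 * (m - i) := by omega
  rw [h2]
  exact ((isPalindromic_X_sq_add_one.pow i).mul (isPalindromic_X.pow (m - i))).C_mul _

theorem symLift_sub (m : ℕ) (h g : F[X]) : symLift m (h - g) = symLift m h - symLift m g := by
  simp only [symLift, coeff_sub, C_sub, sub_mul, Finset.sum_sub_distrib]

theorem symLift_add (m : ℕ) (h g : F[X]) : symLift m (h + g) = symLift m h + symLift m g := by
  simp only [symLift, coeff_add, C_add, add_mul, Finset.sum_add_distrib]

theorem coeff_symLift {m d : ℕ} {h : F[X]} (hdm : d ≤ m) (hd : h.natDegree ≤ d) :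
    (symLift m h).coeff (m + d) = h.coeff d := by
  rw [symLift, finsetSum_coeff, Finset.sum_eq_single_of_mem d (Finset.mem_range_succ_iff.2 hdm)]
  · have e : m + d = 2 * d + (m - d) := by omega
    have hm : ((X ^ 2 + 1 : F[X]) ^ d).coeff (2 * d) = 1 := by
      have h1 : (X ^ 2 + 1 : F[X]).Monic := by
        simpa using monic_X_pow_add_C (1 : F) two_ne_zero
      have h2 : (X ^ 2 + 1 : F[X]).natDegree = 2 := by
        simpa using natDegree_X_pow_add_C (n := 2) (r := (1 : F))
      have h3 := (h1.pow d).coeff_natDegree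
      rwa [h1.natDegree_pow, h2, mul_comm] at h3
    rw [coeff_C_mul, e, coeff_mul_X_pow, hm, mul_one]
  · intro i hi hid
    rcases lt_or_gt_of_ne hid with hlt | hgt
    · rw [Finset.mem_range_succ_iff] at hi
      rw [coeff_C_mul]
      refine mul_eq_zero_of_right _ (coeff_eq_zero_of_natDegree_lt ?_)
      refine lt_of_le_of_lt (natDegree_mul_le_of_le
        ((isPalindromic_X_sq_add_one (F := F)).pow i).1 (natDegree_X_pow (R := F) (m - i)).le) ?_
      omega
    · rw [coeff_eq_zero_of_natDegree_lt (hd.trans_lt hgt), C_0, zero_mul, coeff_zero]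

theorem symLift_eq_zero {m : ℕ} {h : F[X]} (hd : h.natDegree ≤ m) (h0 : symLift m h = 0) :
    h = 0 := by
  have := coeff_symLift hd le_rfl
  rwa [h0, coeff_zero, eq_comm, ← leadingCoeff, leadingCoeff_eq_zero] at this

theorem symLift_injOn (m : ℕ) : Set.InjOn (symLift m) {h : F[X] | h.natDegree ≤ m} := by
  intro h hh g hg heq
  refine sub_eq_zero.1 (symLift_eq_zero (m := m)
    ((natDegree_sub_le_of_le hh hg).trans_eq (max_self m)) ?_)
  rw [symLift_sub, heq, sub_self]

theorem natDegree_symLift {m : ℕ} {h : F[X]} (hm : h.Monic) (hd : h.natDegree = m) :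
    (symLift m h).natDegree = 2 * m := by
  refine natDegree_eq_of_le_of_coeff_ne_zero (isPalindromic_symLift m h).1 ?_
  rw [two_mul, coeff_symLift le_rfl hd.le, ← hd, hm.coeff_natDegree]
  exact one_ne_zero

theorem monic_symLift {m : ℕ} {h : F[X]} (hm : h.Monic) (hd : h.natDegree = m) :
    (symLift m h).Monic := by
  rw [Monic, leadingCoeff, natDegree_symLift hm hd, two_mul, coeff_symLift le_rfl hd.le, ← hd,
    hm.coeff_natDegree]

theorem algebraMap_symLift {m : ℕ} {h : F[X]} (hd : h.natDegree ≤ m) :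
    algebraMap F[X] (RatFunc F) (symLift m h) =
      RatFunc.X ^ m * aeval (RatFunc.X + (RatFunc.X : RatFunc F)⁻¹) h := by
  have hX : (RatFunc.X : RatFunc F) ≠ 0 := RatFunc.X_ne_zero
  rw [symLift, map_sum, aeval_eq_sum_range' (Nat.lt_succ_of_le hd), Finset.mul_sum]
  refine Finset.sum_congr rfl fun i hi => ?_
  rw [Finset.mem_range_succ_iff] at hi
  have h1 : (RatFunc.X + (RatFunc.X : RatFunc F)⁻¹) ^ i * RatFunc.X ^ i =
      (RatFunc.X ^ 2 + 1) ^ i := by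
    rw [← mul_pow, add_mul, inv_mul_cancel₀ hX, sq]
  have h2 : (RatFunc.X : RatFunc F) ^ m = RatFunc.X ^ i * RatFunc.X ^ (m - i) := by
    rw [← pow_add, Nat.add_sub_cancel' hi]
  simp only [map_mul, map_pow, map_add, map_one, RatFunc.algebraMap_X, RatFunc.algebraMap_C,
    Algebra.smul_def, ← h1, h2, RatFunc.algebraMap_eq_C]
  ring

theorem symLift_mul {m₁ m₂ : ℕ} {h₁ h₂ : F[X]} (hd₁ : h₁.natDegree ≤ m₁)
    (hd₂ : h₂.natDegree ≤ m₂) :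
    symLift (m₁ + m₂) (h₁ * h₂) = symLift m₁ h₁ * symLift m₂ h₂ := by
  apply RatFunc.algebraMap_injective F
  rw [map_mul, algebraMap_symLift hd₁, algebraMap_symLift hd₂,
    algebraMap_symLift (natDegree_mul_le_of_le hd₁ hd₂), map_mul]
  ring

theorem symLift_succ {m : ℕ} {h : F[X]} (hd : h.natDegree ≤ m) :
    symLift (m + 1) h = X * symLift m h := by
  have h1 : symLift 1 (1 : F[X]) = X := by
    simp [symLift, coeff_one]
  rw [← h1, mul_comm, ← symLift_mul hd (by simp), mul_one]

theorem symLift_X_add_C (c : F) : symLift 1 (X + C c) = X ^ 2 + C c * X + 1 := by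
  simp [symLift, Finset.sum_range_succ, coeff_X, coeff_C]
  ring

theorem IsPalindromic.exists_symLift {m : ℕ} {p : F[X]} (hp : IsPalindromic (2 * m) p) :
    ∃ h : F[X], h.natDegree ≤ m ∧ symLift m h = p := by
  induction m generalizing p with
  | zero =>
    refine ⟨p, hp.1, ?_⟩
    conv_rhs => rw [eq_C_of_natDegree_le_zero hp.1]
    simp [symLift]
  | succ m ih =>
    set c := p.coeff (2 * (m + 1)) with hc
    set r := p - C c * (X ^ 2 + 1) ^ (m + 1) with hr
    have hXd : (C c * X ^ (m + 1) : F[X]).natDegree ≤ m + 1 := natDegree_C_mul_X_pow_le _ _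
    have hlift : symLift (m + 1) (C c * X ^ (m + 1)) = C c * (X ^ 2 + 1) ^ (m + 1) := by
      rw [symLift, Finset.sum_eq_single_of_mem (m + 1) (by simp)]
      · simp
      · intro i _ hi
        simp [coeff_X_pow, hi]
    have hpr : IsPalindromic (2 * (m + 1)) r := hp.sub ((isPalindromic_X_sq_add_one.pow _).C_mul c)
    have htop : r.coeff (2 * (m + 1)) = 0 := by
      rw [hr, coeff_sub, ← hlift]
      rw [two_mul, coeff_symLift le_rfl hXd, ← two_mul]
      simp [hc]
    have hbot : r.coeff 0 = 0 := by rw [← hpr.coeff_rev (Nat.zero_le _), Nat.sub_zero, htop]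
    have hX : r = X * r.divX := by
      conv_lhs => rw [← X_mul_divX_add r, hbot, C_0, add_zero]
    have hdX : IsPalindromic (2 * m) r.divX := by
      refine isPalindromic_of_coeff ?_ fun i hi => ?_
      · refine natDegree_le_iff_coeff_eq_zero.2 fun N hN => ?_
        rw [coeff_divX]
        rcases eq_or_lt_of_le (show 2 * (m + 1) ≤ N + 1 by omega) with h | h
        · rw [← h, htop]
        · exact coeff_eq_zero_of_natDegree_lt (hpr.1.trans_lt h)
      · rw [coeff_divX, coeff_divX, ← hpr.coeff_rev (show i + 1 ≤ 2 * (m + 1) by omega)]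
        congr 1
        omega
    obtain ⟨h, hd, hh⟩ := ih hdX
    refine ⟨h + C c * X ^ (m + 1), natDegree_add_le_of_degree_le (by omega) hXd, ?_⟩
    rw [symLift_add, hlift, symLift_succ hd, hh, ← hX, hr, sub_add_cancel]

end StarSymmetric

section Decomposition

variable {F : Type} [Field F]

/-- The product `(X - 1) ^ α * (X + 1) ^ β`. -/
noncomputable def linearPart (F : Type) [Field F] (α β : ℕ) : F[X] :=
  (X - C 1) ^ α * (X - C (-1)) ^ β

theorem monic_linearPart (α β : ℕ) : (linearPart F α β).Monic :=
  ((monic_X_sub_C 1).pow α).mul ((monic_X_sub_C (-1)).pow β)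

theorem natDegree_linearPart (α β : ℕ) : (linearPart F α β).natDegree = α + β := by
  rw [linearPart, ((monic_X_sub_C 1).pow α).natDegree_mul ((monic_X_sub_C (-1)).pow β),
    natDegree_pow, natDegree_pow, natDegree_X_sub_C, natDegree_X_sub_C, mul_one, mul_one]

theorem isStarSymm_linearPart (α β : ℕ) : IsStarSymm (linearPart F α β) :=
  ((isStarSymm_X_sub_C (by ring)).pow α).mul ((isStarSymm_X_sub_C (by ring)).pow β)

theorem linearPart_mul (α β α' β' : ℕ) :
    linearPart F α β * linearPart F α' β' = linearPart F (α + α') (β + β') := by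
  simp only [linearPart, pow_add]
  ring

theorem isStarSymm_symLift {h : F[X]} (hm : h.Monic) :
    IsStarSymm (symLift h.natDegree h) ∧ (symLift h.natDegree h).coeff 0 = 1 :=
  (isPalindromic_symLift _ h).isStarSymm (monic_symLift hm rfl) (natDegree_symLift hm rfl)

theorem symLift_natDegree_mul {g h : F[X]} (hg : g.Monic) (hh : h.Monic) :
    symLift (g * h).natDegree (g * h) = symLift g.natDegree g * symLift h.natDegree h := by
  rw [hg.natDegree_mul hh, symLift_mul le_rfl le_rfl]

theorem natDegree_linearPart_mul_symLift (α β : ℕ) {h : F[X]} (hm : h.Monic) :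
    (linearPart F α β * symLift h.natDegree h).natDegree = α + β + 2 * h.natDegree := by
  rw [(monic_linearPart α β).natDegree_mul (monic_symLift hm rfl), natDegree_linearPart,
    natDegree_symLift hm rfl]

theorem coeff_zero_linearPart_mul_symLift (α β : ℕ) {h : F[X]} (hm : h.Monic) :
    (linearPart F α β * symLift h.natDegree h).coeff 0 = (linearPart F α β).coeff 0 := by
  rw [mul_coeff_zero, (isStarSymm_symLift hm).2, mul_one]

theorem exists_symLift_X_sub_C_pow {ε : F} (hε : ε * ε = 1) (s : ℕ) :
    ∃ u : F[X], u.Monic ∧ (X - C ε) ^ s = (X - C ε) ^ (s % 2) * symLift u.natDegree u := by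
  have hb : (X + C (-(2 * ε))).Monic := monic_X_add_C _
  have hsq : (X - C ε) ^ 2 = symLift (X + C (-(2 * ε))).natDegree (X + C (-(2 * ε))) := by
    have h1 : C ε * C ε = 1 := by rw [← C_mul, hε, C_1]
    rw [natDegree_X_add_C, symLift_X_add_C, C_neg, C_mul, C_ofNat]
    linear_combination h1
  have key : ∀ i : ℕ, ∃ u : F[X], u.Monic ∧ (X - C ε) ^ (2 * i) = symLift u.natDegree u := by
    intro i
    induction i with
    | zero => exact ⟨1, monic_one, by simp [symLift]⟩
    | succ i ih =>
      obtain ⟨u, hu, h⟩ := ih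
      exact ⟨u * (X + C (-(2 * ε))), hu.mul hb, by
        rw [symLift_natDegree_mul hu hb, ← h, ← hsq, ← pow_add, mul_add_one]⟩
  obtain ⟨u, hu, h⟩ := key (s / 2)
  exact ⟨u, hu, by rw [← h, ← pow_add, Nat.mod_add_div]⟩

theorem exists_linearPart_mod_two (α β : ℕ) {h : F[X]} (hm : h.Monic) :
    ∃ g : F[X], g.Monic ∧ h ∣ g ∧ linearPart F α β * symLift h.natDegree h =
      linearPart F (α % 2) (β % 2) * symLift g.natDegree g := by
  obtain ⟨u, hu, h1⟩ := exists_symLift_X_sub_C_pow (show (1 : F) * 1 = 1 by ring) α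
  obtain ⟨v, hv, h2⟩ := exists_symLift_X_sub_C_pow (show (-1 : F) * -1 = 1 by ring) β
  refine ⟨h * (u * v), hm.mul (hu.mul hv), dvd_mul_right _ _, ?_⟩
  rw [symLift_natDegree_mul hm (hu.mul hv), symLift_natDegree_mul hu hv, linearPart, linearPart,
    h1, h2]
  ring

theorem IsStarSymm.exists_eq_linearPart_mul_symLift {f : F[X]} (hf : IsStarSymm f)
    (hm : f.Monic) : ∃ (α β : ℕ) (h : F[X]), h.Monic ∧
      f = linearPart F α β * symLift h.natDegree h := by
  induction hn : f.natDegree using Nat.strong_induction_on generalizing f with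
  | _ n ih =>
    by_cases hc : Even f.natDegree ∧ f.coeff 0 = 1
    · obtain ⟨⟨m, hme⟩, h0⟩ := hc
      have hp := hf.isPalindromic h0
      rw [hme, ← two_mul] at hp
      obtain ⟨h, hd, rfl⟩ := hp.exists_symLift
      have h1 : h.coeff m = 1 := by
        rw [← coeff_symLift le_rfl hd, ← hme, hm.coeff_natDegree]
      have h2 : h.natDegree = m :=
        natDegree_eq_of_le_of_coeff_ne_zero hd (h1 ▸ one_ne_zero)
      refine ⟨0, 0, h, by rw [Monic, leadingCoeff, h2, h1], ?_⟩
      rw [h2, linearPart, pow_zero, pow_zero, one_mul, one_mul]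
    · obtain ⟨ε, hε, g, rfl⟩ := hf.exists_dvd hm hc
      have hεm : (X - C ε).Monic := monic_X_sub_C ε
      have hg : IsStarSymm g :=
        (isStarSymm_X_sub_C (by rcases hε with rfl | rfl <;> ring)).of_mul_left hf
      have hgm : g.Monic := hεm.of_mul_monic_left hm
      rw [hεm.natDegree_mul hgm, natDegree_X_sub_C] at hn
      obtain ⟨α, β, h, hh, he⟩ := ih _ (by omega) hg hgm rfl
      rcases hε with rfl | rfl
      · refine ⟨α + 1, β, h, hh, ?_⟩
        rw [he, linearPart, linearPart, pow_succ]
        ring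
      · refine ⟨α, β + 1, h, hh, ?_⟩
        rw [he, linearPart, linearPart, pow_succ (X - C (-1)) β]
        ring

/-- A divisor relation between *-symmetric monic polynomials comes from a divisor relation between
monic polynomials of about half the degree. -/
theorem IsStarSymm.exists_symLift_of_dvd {f g : F[X]} (hf : IsStarSymm f) (hfm : f.Monic)
    (hg : IsStarSymm g) (hgm : g.Monic) (hgf : g ∣ f) :
    ∃ α < 2, ∃ β < 2, ∃ α' < 2, ∃ β' < 2, ∃ h u : F[X], h.Monic ∧ u.Monic ∧ u ∣ h ∧
      f = linearPart F α β * symLift h.natDegree h ∧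
      g = linearPart F α' β' * symLift u.natDegree u := by
  obtain ⟨t, rfl⟩ := hgf
  have ht : IsStarSymm t := hg.of_mul_left hf
  have htm : t.Monic := hgm.of_mul_monic_left hfm
  obtain ⟨α₁, β₁, u₁, hu₁, rfl⟩ := hg.exists_eq_linearPart_mul_symLift hgm
  obtain ⟨α₂, β₂, u₂, hu₂, rfl⟩ := ht.exists_eq_linearPart_mul_symLift htm
  obtain ⟨u, hu, -, he⟩ := exists_linearPart_mod_two α₁ β₁ hu₁
  rw [he, mul_mul_mul_comm, linearPart_mul, ← symLift_natDegree_mul hu hu₂]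
  obtain ⟨h, hh, hdvd, he'⟩ := exists_linearPart_mod_two (α₁ % 2 + α₂) (β₁ % 2 + β₂) (hu.mul hu₂)
  exact ⟨_, Nat.mod_lt _ two_pos, _, Nat.mod_lt _ two_pos, _, Nat.mod_lt _ two_pos, _,
    Nat.mod_lt _ two_pos, h, u, hh, hu, (dvd_mul_right _ _).trans hdvd, he', rfl⟩

end Decomposition

section Counting

variable {F : Type} [Field F] [Fintype F]

open Classical in
variable (F) in
/-- The *-symmetric monic polynomials of degree `n` with constant coefficient `a`. -/
noncomputable def starSymms (n : ℕ) (a : F) : Finset F[X] :=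
  (monics F n).filter fun f => IsStarSymm f ∧ f.coeff 0 = a

open Classical in
variable (F) in
/-- The elements of `starSymms F n a` with a *-symmetric monic divisor of degree `k`. -/
noncomputable def starSymmsWithDivisor (n : ℕ) (a : F) (k : ℕ) : Finset F[X] :=
  (starSymms F n a).filter fun f => ∃ g : F[X], g.Monic ∧ IsStarSymm g ∧ g.natDegree = k ∧ g ∣ f

theorem mem_starSymms {n : ℕ} {a : F} {f : F[X]} : f ∈ starSymms F n a ↔
    (f.Monic ∧ f.natDegree = n) ∧ IsStarSymm f ∧ f.coeff 0 = a := by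
  simp [starSymms]

theorem mem_starSymmsWithDivisor {n k : ℕ} {a : F} {f : F[X]} :
    f ∈ starSymmsWithDivisor F n a k ↔ f ∈ starSymms F n a ∧
      ∃ g : F[X], g.Monic ∧ IsStarSymm g ∧ g.natDegree = k ∧ g ∣ f := by
  simp [starSymmsWithDivisor]

theorem card_pow_le_card_starSymms {α β n : ℕ} {a : F} {h : F[X]} (hm : h.Monic)
    (hf : linearPart F α β * symLift h.natDegree h ∈ starSymms F n a) :
    Fintype.card F ^ h.natDegree ≤ (starSymms F n a).card := by
  rw [← card_monics]
  obtain ⟨⟨-, hd⟩, -, h0⟩ := mem_starSymms.1 hf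
  rw [natDegree_linearPart_mul_symLift α β hm] at hd
  rw [coeff_zero_linearPart_mul_symLift α β hm] at h0
  refine Finset.card_le_card_of_injOn (fun g => linearPart F α β * symLift h.natDegree g)
    (fun g hg => ?_) (fun g₁ hg₁ g₂ hg₂ he => ?_)
  · obtain ⟨hgm, hgd⟩ := mem_monics.1 hg
    rw [← hgd] at hd ⊢
    refine mem_starSymms.2 ⟨⟨(monic_linearPart α β).mul (monic_symLift hgm rfl), ?_⟩,
      (isStarSymm_linearPart α β).mul (isStarSymm_symLift hgm).1, ?_⟩
    · rw [natDegree_linearPart_mul_symLift α β hgm, hd]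
    · rw [coeff_zero_linearPart_mul_symLift α β hgm, h0]
  · exact symLift_injOn _ (mem_monics.1 hg₁).2.le (mem_monics.1 hg₂).2.le
      (mul_left_cancel₀ (monic_linearPart α β).ne_zero he)

theorem card_starSymmsWithDivisor_le {n k : ℕ} {a : F} {B : ℝ} (hB : 0 ≤ B)
    (h : ∀ m j : ℕ, 2 * m ≤ n → n ≤ 2 * m + 2 → 2 * j ≤ k → k ≤ 2 * j + 2 →
      ((monicsWithDivisor F m j).card : ℝ) ≤ B * (Fintype.card F : ℝ) ^ m) :
    ((starSymmsWithDivisor F n a k).card : ℝ) ≤ 16 * (B * (starSymms F n a).card) := by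
  classical
  set S := starSymmsWithDivisor F n a k
  let P : (ℕ × ℕ) × ℕ × ℕ → F[X] → Prop := fun i f => ∃ h u : F[X], h.Monic ∧ u.Monic ∧ u ∣ h ∧
    i.2.1 + i.2.2 + 2 * u.natDegree = k ∧ f = linearPart F i.1.1 i.1.2 * symLift h.natDegree h
  let I := (Finset.range 2 ×ˢ Finset.range 2) ×ˢ Finset.range 2 ×ˢ Finset.range 2
  have hS : S ⊆ I.biUnion fun i => S.filter (P i) := by
    intro f hf
    obtain ⟨hfs, g, hgm, hgs, hgk, hgf⟩ := mem_starSymmsWithDivisor.1 hf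
    obtain ⟨⟨hfm, -⟩, hfs, -⟩ := mem_starSymms.1 hfs
    obtain ⟨α, hα, β, hβ, α', hα', β', hβ', h, u, hh, hu, hdvd, rfl, rfl⟩ :=
      hfs.exists_symLift_of_dvd hfm hgs hgm hgf
    rw [natDegree_linearPart_mul_symLift α' β' hu] at hgk
    refine Finset.mem_biUnion.2 ⟨((α, β), α', β'), ?_, Finset.mem_filter.2 ⟨hf, ?_⟩⟩
    · simp only [I, Finset.mem_product, Finset.mem_range]
      exact ⟨⟨hα, hβ⟩, hα', hβ'⟩
    · exact ⟨h, u, hh, hu, hdvd, hgk, rfl⟩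
  have hI : I.card = 16 := by simp [I]
  have hP : ∀ i ∈ I, ((S.filter (P i)).card : ℝ) ≤ B * (starSymms F n a).card := by
    rintro ⟨⟨α, β⟩, α', β'⟩ hi
    simp only [I, Finset.mem_product, Finset.mem_range] at hi
    rcases (S.filter (P ((α, β), α', β'))).eq_empty_or_nonempty with he | ⟨f₀, hf₀⟩
    · rw [he, Finset.card_empty, Nat.cast_zero]
      positivity
    obtain ⟨hf₀S, h₀, u₀, hh₀, hu₀, -, hk₀, rfl⟩ := Finset.mem_filter.1 hf₀
    have hmem := (mem_starSymmsWithDivisor.1 hf₀S).1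
    have hn₀ := (mem_starSymms.1 hmem).1.2
    rw [natDegree_linearPart_mul_symLift α β hh₀] at hn₀
    have hsub : S.filter (P ((α, β), α', β')) ⊆
        (monicsWithDivisor F h₀.natDegree u₀.natDegree).image fun h =>
          linearPart F α β * symLift h₀.natDegree h := by
      intro f hf
      obtain ⟨hfS, h, u, hh, hu, hdvd, hk, rfl⟩ := Finset.mem_filter.1 hf
      have hn := (mem_starSymms.1 (mem_starSymmsWithDivisor.1 hfS).1).1.2
      rw [natDegree_linearPart_mul_symLift α β hh] at hn
      have hd : h.natDegree = h₀.natDegree := by omega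
      refine Finset.mem_image.2 ⟨h, mem_monicsWithDivisor.2 ⟨⟨hh, hd⟩, u, ⟨hu, ?_⟩, hdvd⟩, ?_⟩
      · dsimp only at hk hk₀
        omega
      · rw [hd]
    have h1 := (Finset.card_le_card hsub).trans Finset.card_image_le
    have h2 := card_pow_le_card_starSymms hh₀ hmem
    dsimp only at hk₀
    calc _ ≤ ((monicsWithDivisor F h₀.natDegree u₀.natDegree).card : ℝ) := by exact_mod_cast h1
      _ ≤ B * (Fintype.card F : ℝ) ^ h₀.natDegree :=
          h _ _ (by omega) (by omega) (by omega) (by omega)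
      _ ≤ _ := mul_le_mul_of_nonneg_left (by exact_mod_cast h2) hB
  calc (S.card : ℝ) ≤ ∑ i ∈ I, ((S.filter (P i)).card : ℝ) := by
        exact_mod_cast (Finset.card_le_card hS).trans Finset.card_biUnion_le
    _ ≤ I.card • (B * (starSymms F n a).card) := Finset.sum_le_card_nsmul _ _ _ hP
    _ = _ := by rw [hI, nsmul_eq_mul, Nat.cast_ofNat]

end Counting

theorem fordDelta_nonneg : 0 ≤ fordDelta := by
  have h0 : 0 < Real.log 2 := Real.log_pos one_lt_two
  have h := Real.log_le_sub_one_of_pos h0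
  rw [fordDelta, sub_nonneg, div_le_one h0]
  linarith

theorem rpow_mul_rpow_le_of_div_four_le {k j : ℕ} (hk : 52 ≤ Real.log k) (hkj : k ≤ 4 * j) :
    (j : ℝ) ^ (-fordDelta) * (1 + Real.log j) ^ (-(1 / 2) : ℝ) ≤
      4 ^ fordDelta * 2 * ((k : ℝ) ^ (-fordDelta) * (1 + Real.log k) ^ (-(1 / 2) : ℝ)) := by
  have hl : Real.log 4 < 1.4 := by
    have h2 := Real.log_two_lt_d9
    rw [show (4 : ℝ) = 2 ^ 2 by norm_num, Real.log_pow]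
    push_cast
    linarith
  have hk0 : (0 : ℝ) < k := by
    rcases Nat.eq_zero_or_pos k with rfl | h
    · norm_num at hk
    · exact_mod_cast h
  have hkj' : (k : ℝ) ≤ 4 * j := by exact_mod_cast hkj
  have hlog : Real.log k - 1.4 ≤ Real.log j := by
    have := Real.log_le_log hk0 hkj'
    rw [Real.log_mul (by norm_num) (by linarith)] at this
    linarith
  have h1 : (j : ℝ) ^ (-fordDelta) ≤ 4 ^ fordDelta * (k : ℝ) ^ (-fordDelta) := by
    calc (j : ℝ) ^ (-fordDelta) ≤ (k / 4 : ℝ) ^ (-fordDelta) :=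
          Real.rpow_le_rpow_of_nonpos (by positivity) (by linarith)
            (neg_nonpos.2 fordDelta_nonneg)
      _ = _ := by
          rw [Real.div_rpow hk0.le (by norm_num), Real.rpow_neg (by norm_num : (0 : ℝ) ≤ 4),
            div_inv_eq_mul, mul_comm]
  have h2 : (1 + Real.log j) ^ (-(1 / 2) : ℝ) ≤ 2 * (1 + Real.log k) ^ (-(1 / 2) : ℝ) := by
    calc (1 + Real.log j) ^ (-(1 / 2) : ℝ) ≤ ((1 + Real.log k) / 2 ^ (2 : ℝ)) ^ (-(1 / 2) : ℝ) := by
          refine Real.rpow_le_rpow_of_nonpos (by positivity) ?_ (by norm_num)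
          norm_num at hlog ⊢
          linarith
      _ = _ := by
          rw [Real.div_rpow (by positivity) (by positivity), ← Real.rpow_mul (by norm_num)]
          norm_num [Real.rpow_neg_one]
          ring
  calc _ ≤ (4 ^ fordDelta * (k : ℝ) ^ (-fordDelta)) * (2 * (1 + Real.log k) ^ (-(1 / 2) : ℝ)) :=
        mul_le_mul h1 h2 (Real.rpow_nonneg (by linarith) _) (by positivity)
    _ = _ := by ring

theorem card_starSymmsWithDivisor_le_of_large {F : Type} [Field F] [Fintype F] {n k : ℕ} {a : F}
    (hk : 52 ≤ Real.log k) (hkn : 2 * k ≤ n) :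
    ((starSymmsWithDivisor F n a k).card : ℝ) ≤
      16 * (1869 * Real.exp 12 * (4 ^ fordDelta * 2)) * (starSymms F n a).card *
        ((k : ℝ) ^ (-fordDelta) * (1 + Real.log k) ^ (-(1 / 2) : ℝ)) := by
  have hk4 : 4 ≤ k := by
    by_contra! h
    have h1 : (k : ℝ) ≤ 4 := by exact_mod_cast h.le
    have h2 := Real.log_le_self (Nat.cast_nonneg (α := ℝ) k)
    linarith
  have h := card_starSymmsWithDivisor_le (F := F) (n := n) (k := k) (a := a)
    (B := 1869 * Real.exp 12 * (4 ^ fordDelta * 2 *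
      ((k : ℝ) ^ (-fordDelta) * (1 + Real.log k) ^ (-(1 / 2) : ℝ)))) (by positivity)
    fun m j hm1 hm2 hj1 hj2 => ?_
  · refine h.trans_eq ?_
    ring
  · have hkj : k ≤ 4 * j := by omega
    have hj : 50 ≤ Real.log j := by
      have hkj' : (k : ℝ) ≤ 4 * j := by exact_mod_cast hkj
      have hk0 : (0 : ℝ) < k := by exact_mod_cast (by omega : 0 < k)
      have hlog := Real.log_le_log hk0 hkj'
      rw [Real.log_mul (by norm_num) (by linarith)] at hlog
      have h2 := Real.log_two_lt_d9
      rw [show (4 : ℝ) = 2 ^ 2 by norm_num, Real.log_pow] at hlog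
      push_cast at hlog
      linarith
    have h1 := card_monicsWithDivisor_le F hj (show 2 * j ≤ m + 1 by omega)
    refine h1.trans ?_
    rw [mul_right_comm]
    refine mul_le_mul_of_nonneg_right ?_ (by positivity)
    exact mul_le_mul_of_nonneg_left (rpow_mul_rpow_le_of_div_four_le hk hkj) (by positivity)

theorem one_le_mul_rpow_of_log_le {k : ℕ} (hk1 : 1 ≤ k) (hk : Real.log k ≤ 52) :
    1 ≤ Real.exp (52 * fordDelta) * 53 ^ (1 / 2 : ℝ) *
      ((k : ℝ) ^ (-fordDelta) * (1 + Real.log k) ^ (-(1 / 2) : ℝ)) := by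
  have hk0 : (0 : ℝ) < k := by exact_mod_cast hk1
  have hlog : 0 ≤ Real.log k := Real.log_natCast_nonneg k
  have h1 : 1 ≤ Real.exp (52 * fordDelta) * (k : ℝ) ^ (-fordDelta) := by
    rw [Real.rpow_def_of_pos hk0, ← Real.exp_add]
    refine Real.one_le_exp ?_
    nlinarith [fordDelta_nonneg]
  have h2 : 1 ≤ 53 ^ (1 / 2 : ℝ) * (1 + Real.log k) ^ (-(1 / 2) : ℝ) := by
    rw [Real.rpow_neg (by linarith), ← div_eq_mul_inv, one_le_div (by positivity)]
    exact Real.rpow_le_rpow (by linarith) (by linarith) (by norm_num)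
  calc (1 : ℝ) ≤ _ := one_le_mul_of_one_le_of_one_le h1 h2
    _ = _ := by ring

/-- **Multiplication table problem, *-symmetric case.**
The number of *-symmetric monic polynomials of degree `n` over a finite field with `q`
elements, with constant coefficient `a = ±1`, having a *-symmetric monic divisor of degree `k`
(where `1 ≤ k ≤ n/2`), is `≤ C N k^{-δ} (1 + log k)^{-1/2}`, where `N` is the total number of
*-symmetric monic polynomials of degree `n` with constant coefficient `a`. -/
theorem stmt8 : ∃ C : ℝ, 0 < C ∧
    ∀ (F : Type) [Field F] [Fintype F], ∀ (q n k : ℕ) (a : F),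
      Fintype.card F = q → 2 ≤ n → 1 ≤ k → 2 * k ≤ n → (a = 1 ∨ a = -1) →
      ({f : F[X] | f.Monic ∧ IsStarSymm f ∧ f.natDegree = n ∧ f.coeff 0 = a ∧
          ∃ g : F[X], g.Monic ∧ IsStarSymm g ∧ g.natDegree = k ∧ g ∣ f}.ncard : ℝ) ≤
        C * ({f : F[X] | f.Monic ∧ IsStarSymm f ∧ f.natDegree = n ∧
              f.coeff 0 = a}.ncard : ℝ) *
          (k : ℝ) ^ (-fordDelta) * (1 + Real.log k) ^ (-(1 / 2) : ℝ) := by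
  set c₁ : ℝ := 16 * (1869 * Real.exp 12 * (4 ^ fordDelta * 2)) with hc₁
  set c₂ : ℝ := Real.exp (52 * fordDelta) * 53 ^ (1 / 2 : ℝ) with hc₂
  have h₁ : 0 < c₁ := by positivity
  have h₂ : 0 < c₂ := by positivity
  refine ⟨c₁ + c₂, by positivity, ?_⟩
  intro F _ _ q n k a _ _ hk1 hkn _
  have e₁ : {f : F[X] | f.Monic ∧ IsStarSymm f ∧ f.natDegree = n ∧ f.coeff 0 = a} =
      (starSymms F n a : Set F[X]) := by
    ext f
    rw [Finset.mem_coe, mem_starSymms, Set.mem_ofPred_eq]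
    tauto
  have e₂ : {f : F[X] | f.Monic ∧ IsStarSymm f ∧ f.natDegree = n ∧ f.coeff 0 = a ∧
      ∃ g : F[X], g.Monic ∧ IsStarSymm g ∧ g.natDegree = k ∧ g ∣ f} =
      (starSymmsWithDivisor F n a k : Set F[X]) := by
    ext f
    rw [Finset.mem_coe, mem_starSymmsWithDivisor, mem_starSymms, Set.mem_ofPred_eq]
    constructor
    · rintro ⟨h1, h2, h3, h4, h5⟩
      exact ⟨⟨⟨h1, h3⟩, h2, h4⟩, h5⟩
    · rintro ⟨⟨⟨h1, h3⟩, h2, h4⟩, h5⟩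
      exact ⟨h1, h2, h3, h4, h5⟩
  rw [e₁, e₂, Set.ncard_coe_finset, Set.ncard_coe_finset, mul_assoc]
  set N : ℝ := ((starSymms F n a).card : ℝ)
  set b : ℝ := (k : ℝ) ^ (-fordDelta) * (1 + Real.log k) ^ (-(1 / 2) : ℝ) with hb
  have hN : 0 ≤ N := Nat.cast_nonneg _
  have hb0 : 0 ≤ b := by
    have := Real.log_natCast_nonneg k
    positivity
  rcases le_total 52 (Real.log k) with hk | hk
  · refine (card_starSymmsWithDivisor_le_of_large hk hkn).trans ?_
    rw [← hc₁, ← hb]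
    gcongr
    linarith
  · have hle : ((starSymmsWithDivisor F n a k).card : ℝ) ≤ N := by
      exact Nat.cast_le.2 (Finset.card_le_card fun f hf => (mem_starSymmsWithDivisor.1 hf).1)
    have h1 : 1 ≤ c₂ * b := one_le_mul_rpow_of_log_le hk1 hk
    calc _ ≤ N * 1 := by rw [mul_one]; exact hle
      _ ≤ N * (c₂ * b) := mul_le_mul_of_nonneg_left h1 hN
      _ ≤ (c₁ + c₂) * N * b := by nlinarith [mul_nonneg (mul_nonneg h₁.le hN) hb0]
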